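/- arXiv:1005.0128 — 2 statements merged into one kernel-verified Lean document; each statement's English description precedes it below -/
import Mathlib

section
/- Let r̲ be a rational subspace of dimension i and let f ∈ G(X)_i (i.e. f ∈ G(X) and ∂_{X∖t̲} f = 0 for all rational t̲ of dimension i−1). Then ∂_{X∖r̲} f, which lies in S'(g*, r̲) ≅ S'(r̲), is a polynomial density belonging to D(X∩r̲). -/
/-!
STATEMENT 13: Let r̲ be a rational subspace of dimension i and f ∈ G(X)_i.
Then ∂_{X∖r̲} f, which lies in S'(g*, r̲) ≅ S'(r̲), is a polynomial density
belonging to D(X∩r̲).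
-/

noncomputable section

open scoped BigOperators
open MeasureTheory

abbrev Vg (n : ℕ) := EuclideanSpace ℝ (Fin n)

/-- Generalized functions on g*: functionals on test functions. -/
abbrev GDist (n : ℕ) := (Vg n → ℝ) → ℝ

/-- Distributional directional derivative along `a`. -/
def dirD {n : ℕ} (a : Vg n) (T : GDist n) : GDist n :=
  fun f => - T (fun x => fderiv ℝ f x a)

/-- Iterated distributional derivative ∂_Y along the sublist of X indexed by S. -/
def iterD {n m : ℕ} (X : Fin m → Vg n) (S : Finset (Fin m)) (T : GDist n) :
    GDist n :=
  S.toList.foldr (fun i T => dirD (X i) T) T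

/-- Convolution of generalized functions. -/
def conv {n : ℕ} (S T : GDist n) : GDist n :=
  fun f => S fun x => T fun y => f (x + y)

/-- Equality as tempered distributions. -/
def DEq {n : ℕ} (S T : GDist n) : Prop :=
  ∀ f : SchwartzMap (Vg n) ℝ, S ⇑f = T ⇑f

/-- A subspace is rational (w.r.t. X) if it is spanned by the elements of X
lying in it. -/
def RationalSub {n m : ℕ} (X : Fin m → Vg n) (W : Submodule ℝ (Vg n)) : Prop :=
  W = Submodule.span ℝ (Set.range X ∩ ↑W)

open Classical in
/-- Indices of the elements of X lying in W (the sublist X ∩ W). -/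
def idxIn {n m : ℕ} (X : Fin m → Vg n) (W : Submodule ℝ (Vg n)) :
    Finset (Fin m) :=
  Finset.univ.filter fun i => X i ∈ W

open Classical in
/-- Indices of the elements of X not lying in W (the sublist X ∖ W). -/
def idxOut {n m : ℕ} (X : Fin m → Vg n) (W : Submodule ℝ (Vg n)) :
    Finset (Fin m) :=
  Finset.univ.filter fun i => X i ∉ W

/-- The sign ±1 of a vector `a` with respect to a regular element `φ`. -/
def sgn {n : ℕ} (φ a : Vg n) : ℝ := if 0 < inner (𝕜 := ℝ) φ a then 1 else -1

/-- The signed multivariate spline T_Z^F attached to the sublist of X indexed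
by S and the regular face determined by φ:  T_Z^F = (−1)^{|B|} T_{(A,−B)}. -/
def TSF {n m : ℕ} (X : Fin m → Vg n) (S : Finset (Fin m)) (φ : Vg n) :
    GDist n :=
  fun f => (∏ i : ↥S, sgn φ (X i)) *
    ∫ t : (↥S → ℝ) in {t | ∀ i, 0 ≤ t i}, f (∑ i, t i • sgn φ (X i) • X i)

/-- Evaluation of a polynomial at a point of g*. -/
def evalP {n : ℕ} (p : MvPolynomial (Fin n) ℝ) (x : Vg n) : ℝ :=
  MvPolynomial.eval (fun i => x i) p

/-- The polynomial density p(w) dw on the subspace W (with the Lebesgue measure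
attached to an orthonormal basis of W), viewed as a generalized function. -/
def densOn {n : ℕ} (W : Submodule ℝ (Vg n)) (p : MvPolynomial (Fin n) ℝ) :
    GDist n :=
  fun f => ∫ t : Fin (Module.finrank ℝ W) → ℝ,
    evalP p ((∑ j, t j • stdOrthonormalBasis ℝ W j : W) : Vg n) *
      f ((∑ j, t j • stdOrthonormalBasis ℝ W j : W) : Vg n)

/-- Directional derivative of polynomials along `a`. -/
def pdirD {n : ℕ} (a : Vg n) : Module.End ℝ (MvPolynomial (Fin n) ℝ) :=
  ∑ i, a i • (MvPolynomial.pderiv i).toLinearMap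

/-- The product ∂_Y for the sublist of X indexed by S, acting on polynomials. -/
def piterD {n m : ℕ} (X : Fin m → Vg n) (S : Finset (Fin m)) :
    Module.End ℝ (MvPolynomial (Fin n) ℝ) :=
  (S.toList.map fun i => pdirD (X i)).prod

/-- `Z` indexes a cocircuit of the list X∩W inside W:
Z = (X∩W) ∖ H with H a rational hyperplane of W. -/
def CocIn {n m : ℕ} (X : Fin m → Vg n) (W : Submodule ℝ (Vg n))
    (Z : Finset (Fin m)) : Prop :=
  ∃ H : Submodule ℝ (Vg n), RationalSub X H ∧ H ≤ W ∧
    Module.finrank ℝ H + 1 = Module.finrank ℝ W ∧ Z = idxIn X W \ idxIn X H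

/-- `p` defines (by restriction to W) an element of D(X∩W): all cocircuit
derivatives of `p` for the list X∩W vanish on W. -/
def DcondOn {n m : ℕ} (X : Fin m → Vg n) (W : Submodule ℝ (Vg n))
    (p : MvPolynomial (Fin n) ℝ) : Prop :=
  ∀ Z : Finset (Fin m), CocIn X W Z → ∀ w : W, evalP (piterD X Z p) ↑w = 0

/-- T belongs to S'(g*, W): T (tested on Schwartz functions) factors through
restriction to W. -/
def SuppOn {n : ℕ} (W : Submodule ℝ (Vg n)) (T : GDist n) : Prop :=
  ∀ f g : SchwartzMap (Vg n) ℝ, (∀ w : W, f ↑w = g ↑w) → T ⇑f = T ⇑g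

/-- The spline space G(X):  ∂_{X∖W} T ∈ S'(g*, W) for every rational W. -/
def GX {n m : ℕ} (X : Fin m → Vg n) : Set (GDist n) :=
  {T | ∀ W : Submodule ℝ (Vg n), RationalSub X W →
    SuppOn W (iterD X (idxOut X W) T)}

/-- The filtration G(X)_i:  members of G(X) killed by ∂_{X∖t̲} for every
rational t̲ of dimension i − 1. -/
def GXf {n m : ℕ} (X : Fin m → Vg n) (i : ℕ) : Set (GDist n) :=
  GX X ∩ {T | ∀ W : Submodule ℝ (Vg n), RationalSub X W →
    Module.finrank ℝ W + 1 = i → DEq (iterD X (idxOut X W) T) 0}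


section avg
open scoped SchwartzMap

theorem avg_integrable {V F Ω : Type} [NormedAddCommGroup V] [NormedSpace ℝ V]
    [NormedAddCommGroup F] [NormedSpace ℝ F] [MeasurableSpace Ω] (μ : Measure Ω)
    (w : Ω → ℝ) (φ : Ω → V) (hw : Integrable w μ) (hφ : AEStronglyMeasurable φ μ)
    (v : 𝓢(V, F)) (x : V) : Integrable (fun ω => w ω • v (x - φ ω)) μ := by
  obtain ⟨C, hC, hv⟩ := v.decay 0 0
  have hm : AEStronglyMeasurable (fun ω => v (x - φ ω)) μ :=
    v.continuous.comp_aestronglyMeasurable (aestronglyMeasurable_const.sub hφ)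
  exact Integrable.smul_bdd hw C hm (ae_of_all _ fun ω => by simpa using hv (x - φ ω))

theorem avg_hasFDerivAt {V F Ω : Type} [NormedAddCommGroup V] [NormedSpace ℝ V]
    [NormedAddCommGroup F] [NormedSpace ℝ F] [MeasurableSpace Ω] (μ : Measure Ω)
    (w : Ω → ℝ) (φ : Ω → V) (hw : Integrable w μ) (hφ : AEStronglyMeasurable φ μ)
    (v : 𝓢(V, F)) (x : V) :
    HasFDerivAt (fun x => ∫ ω, w ω • v (x - φ ω) ∂μ)
      (∫ ω, w ω • SchwartzMap.fderivCLM ℝ V F v (x - φ ω) ∂μ) x := by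
  obtain ⟨C, hC, hv⟩ := (SchwartzMap.fderivCLM ℝ V F v).decay 0 0
  refine hasFDerivAt_integral_of_dominated_of_fderiv_le (s := Set.univ)
    (F' := fun x ω => w ω • SchwartzMap.fderivCLM ℝ V F v (x - φ ω))
    (bound := fun ω => ‖w ω‖ * C) Filter.univ_mem
    (Filter.Eventually.of_forall fun x => (avg_integrable μ w φ hw hφ v x).aestronglyMeasurable)
    (avg_integrable μ w φ hw hφ v x)
    (avg_integrable μ w φ hw hφ _ x).aestronglyMeasurable
    (ae_of_all _ fun ω y _ => ?_) (hw.norm.mul_const C) (ae_of_all _ fun ω y _ => ?_)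
  · rw [norm_smul]
    gcongr
    simpa using hv (y - φ ω)
  · have h1 : HasFDerivAt (fun y => v (y - φ ω)) (fderiv ℝ v (y - φ ω)) y := by
      simpa [Function.comp_def] using (v.hasFDerivAt (y - φ ω)).comp y ((hasFDerivAt_id y).sub_const (φ ω))
    exact h1.const_smul (w ω)

theorem avg_contDiff {V Ω : Type} [NormedAddCommGroup V] [NormedSpace ℝ V]
    [MeasurableSpace Ω] (μ : Measure Ω)
    (w : Ω → ℝ) (φ : Ω → V) (hw : Integrable w μ) (hφ : AEStronglyMeasurable φ μ) (N : ℕ) :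
    ∀ (F : Type) [NormedAddCommGroup F] [NormedSpace ℝ F] (v : 𝓢(V, F)),
    ContDiff ℝ N (fun x => ∫ ω, w ω • v (x - φ ω) ∂μ) := by
  induction N with
  | zero =>
    intro F _ _ v
    exact contDiff_zero.2 (continuous_iff_continuousAt.2 fun x =>
      (avg_hasFDerivAt μ w φ hw hφ v x).continuousAt)
  | succ N ih =>
    intro F _ _ v
    have := (contDiff_succ_iff_hasFDerivAt (𝕜 := ℝ) (n := N)
      (f := fun x => ∫ ω, w ω • v (x - φ ω) ∂μ)).2 ⟨_, ih _ (SchwartzMap.fderivCLM ℝ V F v), avg_hasFDerivAt μ w φ hw hφ v⟩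
    exact_mod_cast this

theorem avg_decay {V Ω : Type} [NormedAddCommGroup V] [NormedSpace ℝ V]
    [MeasurableSpace Ω] (μ : Measure Ω)
    (w : Ω → ℝ) (φ : Ω → V) (hw : ∀ k : ℕ, Integrable (fun ω => ‖φ ω‖ ^ k * w ω) μ)
    (hφ : AEStronglyMeasurable φ μ) (k N : ℕ) :
    ∀ (F : Type) [NormedAddCommGroup F] [NormedSpace ℝ F] (v : 𝓢(V, F)),
    ∃ C : ℝ, ∀ x, ‖x‖ ^ k * ‖iteratedFDeriv ℝ N (fun x => ∫ ω, w ω • v (x - φ ω) ∂μ) x‖ ≤ C := by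
  have hw0 : Integrable w μ := by simpa using hw 0
  induction N with
  | zero =>
    intro F _ _ v
    obtain ⟨C, hC, hv⟩ := v.decay k 0
    obtain ⟨C', hC', hv'⟩ := v.decay 0 0
    refine ⟨∫ ω, 2 ^ k * (‖w ω‖ * C + ‖‖φ ω‖ ^ k * w ω‖ * C') ∂μ, fun x => ?_⟩
    have : ‖x‖ ^ k * ‖iteratedFDeriv ℝ 0 (fun x => ∫ ω, w ω • v (x - φ ω) ∂μ) x‖
      = ‖∫ ω, (‖x‖ ^ k) • (w ω • v (x - φ ω)) ∂μ‖ := by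
      rw [integral_smul, norm_smul]; simp
    rw [this]
    refine norm_integral_le_of_norm_le ?_ (ae_of_all _ fun ω => ?_)
    · exact ((hw0.norm.mul_const C).add ((hw k).norm.mul_const C')).const_mul _
    · have h1 := hv (x - φ ω)
      have h2 := hv' (x - φ ω)
      simp only [norm_iteratedFDeriv_zero, pow_zero, one_mul] at h1 h2
      have h3 : ‖x‖ ^ k ≤ 2 ^ k * (‖x - φ ω‖ ^ k + ‖φ ω‖ ^ k) := by
        have : ‖x‖ ≤ ‖x - φ ω‖ + ‖φ ω‖ := by simpa using norm_add_le (x - φ ω) (φ ω)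
        refine (pow_le_pow_left₀ (norm_nonneg _) this k).trans ((add_pow_le (norm_nonneg _) (norm_nonneg _) k).trans ?_)
        gcongr
        · norm_num
        · omega
      simp only [norm_smul, norm_pow, norm_norm, norm_mul]
      calc ‖x‖ ^ k * (‖w ω‖ * ‖v (x - φ ω)‖)
          ≤ (2 ^ k * (‖x - φ ω‖ ^ k + ‖φ ω‖ ^ k)) * (‖w ω‖ * ‖v (x - φ ω)‖) := by gcongr
        _ = 2 ^ k * (‖w ω‖ * (‖x - φ ω‖ ^ k * ‖v (x - φ ω)‖) + ‖φ ω‖ ^ k * ‖w ω‖ * ‖v (x - φ ω)‖) := by ring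
        _ ≤ _ := by gcongr
  | succ N ih =>
    intro F _ _ v
    obtain ⟨C, hC⟩ := ih _ (SchwartzMap.fderivCLM ℝ V F v)
    refine ⟨C, fun x => ?_⟩
    rw [← norm_iteratedFDeriv_fderiv]
    have : fderiv ℝ (fun x => ∫ ω, w ω • v (x - φ ω) ∂μ) = 
      fun x => ∫ ω, w ω • SchwartzMap.fderivCLM ℝ V F v (x - φ ω) ∂μ :=
      funext fun x => (avg_hasFDerivAt μ w φ hw0 hφ v x).fderiv
    rw [this]
    exact hC x

theorem avg_schwartz {V F Ω : Type} [NormedAddCommGroup V] [NormedSpace ℝ V]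
    [NormedAddCommGroup F] [NormedSpace ℝ F] [MeasurableSpace Ω] (μ : Measure Ω)
    (w : Ω → ℝ) (φ : Ω → V) (hw : ∀ k : ℕ, Integrable (fun ω => ‖φ ω‖ ^ k * w ω) μ)
    (hφ : AEStronglyMeasurable φ μ) (v : 𝓢(V, F)) :
    ∃ h : 𝓢(V, F), ∀ x, h x = ∫ ω, w ω • v (x - φ ω) ∂μ :=
  ⟨⟨fun x => ∫ ω, w ω • v (x - φ ω) ∂μ,
    contDiff_infty.2 fun N => avg_contDiff μ w φ (by simpa using hw 0) hφ N F v,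
    fun k N => avg_decay μ w φ hw hφ k N F v⟩, fun x => rfl⟩
end avg

section divergence
open scoped SchwartzMap

/-- Restriction of Schwartz functions along an injective linear map. -/
theorem exists_restr {V : Type} [NormedAddCommGroup V] [NormedSpace ℝ V] {k : ℕ}
    (ι : (Fin k → ℝ) →L[ℝ] V) (hι : Function.Injective ι) (u : 𝓢(V, ℝ)) :
    ∃ r : 𝓢(Fin k → ℝ, ℝ), ∀ s, r s = u (ι s) := by
  obtain ⟨K, -, hK⟩ := ι.toLinearMap.exists_antilipschitzWith (LinearMap.ker_eq_bot.2 hι)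
  exact ⟨SchwartzMap.compCLMOfAntilipschitz ℝ ι.hasTemperateGrowth hK u, fun s => rfl⟩

theorem weight_integrable {V : Type} [NormedAddCommGroup V] [NormedSpace ℝ V] {k : ℕ}
    (ι : (Fin k → ℝ) →L[ℝ] V) (hι : Function.Injective ι) (u : 𝓢(V, ℝ)) (j : Fin k) (N : ℕ) :
    Integrable (fun ω : ℝ × (Fin k → ℝ) => ‖ω.1 • ι ω.2‖ ^ N * (ω.2 j * u (ι ω.2)))
      ((volume.restrict (Set.Ioc 0 1)).prod volume) := by
  obtain ⟨r, hr⟩ := exists_restr ι hι u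
  have h1 : Integrable (fun t : ℝ => ‖t‖ ^ N) (volume.restrict (Set.Ioc 0 1)) := by
    have : ContinuousOn (fun t : ℝ => ‖t‖ ^ N) (Set.Icc 0 1) := by fun_prop
    exact (this.integrableOn_Icc).mono_set Set.Ioc_subset_Icc_self
  have h2 : Integrable (fun s : Fin k → ℝ => ‖ι s‖ ^ N * (s j * u (ι s))) volume := by
    refine ((r.integrable_pow_mul volume (N + 1)).const_mul (‖ι‖ ^ N)).mono' ?_ ?_
    · exact (Continuous.aestronglyMeasurable (by fun_prop))
    · refine ae_of_all _ fun s => ?_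
      rw [norm_mul, norm_mul, norm_pow, norm_norm, ← hr]
      calc ‖ι s‖ ^ N * (‖s j‖ * ‖r s‖) ≤ (‖ι‖ * ‖s‖) ^ N * (‖s‖ * ‖r s‖) := by
            gcongr
            · exact ι.le_opNorm s
            · exact norm_le_pi_norm s j
        _ = _ := by ring
  refine (h1.mul_prod h2).congr (ae_of_all _ fun ω => ?_)
  simp only [norm_smul]
  ring

theorem exists_div {V : Type} [NormedAddCommGroup V] [NormedSpace ℝ V] {k : ℕ}
    (ι : (Fin k → ℝ) →L[ℝ] V) (hι : Function.Injective ι) (u v : 𝓢(V, ℝ)) :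
    ∃ h : Fin k → 𝓢(V, ℝ), ∀ x, ∑ j, fderiv ℝ (h j) x (ι (Pi.single j 1)) =
      (∫ s, u (ι s)) * v x - ∫ s, u (ι s) * v (x - ι s) := by
  obtain ⟨r, hr⟩ := exists_restr ι hι u
  set μ : Measure (ℝ × (Fin k → ℝ)) := (volume.restrict (Set.Ioc 0 1)).prod volume with hμ
  have hφ : AEStronglyMeasurable (fun ω : ℝ × (Fin k → ℝ) => ω.1 • ι ω.2) μ :=
    Continuous.aestronglyMeasurable (by fun_prop)
  have hw := fun j => weight_integrable ι hι u j
  have hw0 : ∀ j, Integrable (fun ω : ℝ × (Fin k → ℝ) => ω.2 j * u (ι ω.2)) μ :=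
    fun j => by simpa using hw j 0
  choose h hh using fun j => avg_schwartz μ (fun ω => ω.2 j * u (ι ω.2)) (fun ω => ω.1 • ι ω.2)
    (hw j) hφ v
  refine ⟨h, fun x => ?_⟩
  have hd : ∀ j, fderiv ℝ (h j) x (ι (Pi.single j 1)) = ∫ ω, (ω.2 j * u (ι ω.2)) *
      fderiv ℝ v (x - ω.1 • ι ω.2) (ι (Pi.single j 1)) ∂μ := by
    intro j
    rw [show (h j : V → ℝ) = _ from funext (hh j),
      (avg_hasFDerivAt μ _ _ (hw0 j) hφ v x).fderiv,
      ContinuousLinearMap.integral_apply (avg_integrable μ _ _ (hw0 j) hφ _ x)]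
    rfl
  have hi : ∀ j, Integrable (fun ω : ℝ × (Fin k → ℝ) => (ω.2 j * u (ι ω.2)) *
      fderiv ℝ v (x - ω.1 • ι ω.2) (ι (Pi.single j 1))) μ := fun j =>
    (avg_integrable μ _ _ (hw0 j) hφ (SchwartzMap.fderivCLM ℝ V ℝ v) x).apply_continuousLinearMap _
  simp_rw [hd]
  rw [← integral_finsetSum _ fun j _ => hi j]
  have he : ∀ ω : ℝ × (Fin k → ℝ), ∑ j, (ω.2 j * u (ι ω.2)) *
      fderiv ℝ v (x - ω.1 • ι ω.2) (ι (Pi.single j 1)) =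
      u (ι ω.2) * fderiv ℝ v (x - ω.1 • ι ω.2) (ι ω.2) := by
    intro ω
    have : ω.2 = ∑ j, ω.2 j • (Pi.single j (1 : ℝ) : Fin k → ℝ) := by
      simpa using pi_eq_sum_univ' ω.2
    conv_rhs => rw [show fderiv ℝ v (x - ω.1 • ι ω.2) (ι ω.2) =
      fderiv ℝ v (x - ω.1 • ι ω.2) (ι (∑ j, ω.2 j • (Pi.single j (1 : ℝ) : Fin k → ℝ))) by rw [← this]]
    rw [map_sum, map_sum, Finset.mul_sum]
    refine Finset.sum_congr rfl fun j _ => ?_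
    rw [map_smul, map_smul, smul_eq_mul]; ring
  have hi2 := integrable_finsetSum Finset.univ fun j _ => hi j
  simp_rw [he] at hi2 ⊢
  rw [hμ, integral_prod_symm _ hi2]
  have hin : ∀ s : Fin k → ℝ, ∫ t in Set.Ioc (0:ℝ) 1, u (ι s) * fderiv ℝ v (x - t • ι s) (ι s) =
      u (ι s) * v x - u (ι s) * v (x - ι s) := by
    intro s
    rw [← intervalIntegral.integral_of_le zero_le_one, intervalIntegral.integral_const_mul, ← mul_sub]
    congr 1
    have hder : ∀ t ∈ Set.uIcc (0:ℝ) 1, HasDerivAt (fun t : ℝ => - v (x - t • ι s))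
        (fderiv ℝ v (x - t • ι s) (ι s)) t := by
      intro t _
      have h1 : HasDerivAt (fun t : ℝ => x - t • ι s) (-(ι s)) t := by
        simpa using ((hasDerivAt_id t).smul_const (ι s)).const_sub x
      have := ((v.hasFDerivAt (x - t • ι s)).comp_hasDerivAt t h1).neg
      simpa [Function.comp_def] using! this
    rw [intervalIntegral.integral_eq_sub_of_hasDerivAt hder]
    · simp; ring
    · apply Continuous.intervalIntegrable
      have := (SchwartzMap.fderivCLM ℝ V ℝ v).continuous
      have h2 : Continuous fun t : ℝ => SchwartzMap.fderivCLM ℝ V ℝ v (x - t • ι s) (ι s) := by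
        fun_prop
      exact h2
  simp_rw [hin]
  have hu : Integrable (fun s => u (ι s)) (volume : Measure (Fin k → ℝ)) :=
    (r.integrable (μ := volume)).congr (ae_of_all _ hr)
  rw [integral_sub (hu.mul_const _), integral_mul_const]
  exact avg_integrable volume (fun s => u (ι s)) (fun s => ι s) hu
    (Continuous.aestronglyMeasurable (by fun_prop)) v x

theorem exists_div2 {V : Type} [NormedAddCommGroup V] [NormedSpace ℝ V] {k : ℕ}
    (ι : (Fin k → ℝ) →L[ℝ] V) (hι : Function.Injective ι) (u v : 𝓢(V, ℝ)) :
    ∃ h : Fin k → 𝓢(V, ℝ), ∀ s, ∑ j, fderiv ℝ (h j) (ι s) (ι (Pi.single j 1)) =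
      (∫ s, u (ι s)) * v (ι s) - (∫ s, v (ι s)) * u (ι s) := by
  obtain ⟨h1, hh1⟩ := exists_div ι hι u v
  obtain ⟨h2, hh2⟩ := exists_div ι hι v u
  refine ⟨fun j => h1 j - h2 j, fun s => ?_⟩
  have : ∀ j, fderiv ℝ (h1 j - h2 j : 𝓢(V, ℝ)) (ι s) (ι (Pi.single j 1)) =
      fderiv ℝ (h1 j) (ι s) (ι (Pi.single j 1)) - fderiv ℝ (h2 j) (ι s) (ι (Pi.single j 1)) := by
    intro j
    have := congrArg (fun F : 𝓢(V, V →L[ℝ] ℝ) => F (ι s) (ι (Pi.single j 1)))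
      (map_sub (SchwartzMap.fderivCLM ℝ V ℝ) (h1 j) (h2 j))
    exact this
  simp_rw [this]
  rw [Finset.sum_sub_distrib, hh1, hh2]
  have hc : ∫ y, v (ι y) * u (ι s - ι y) = ∫ y, u (ι y) * v (ι s - ι y) := by
    rw [← integral_sub_left_eq_self _ volume s]
    refine integral_congr_ae (ae_of_all _ fun y => ?_)
    simp [mul_comm]
  rw [hc]; ring
end divergence

section polydens
open scoped SchwartzMap

theorem eval_hasFDerivAt {k : ℕ} (q : MvPolynomial (Fin k) ℝ) (s : Fin k → ℝ) :
    HasFDerivAt (fun s : Fin k → ℝ => MvPolynomial.eval s q)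
      (∑ j, MvPolynomial.eval s (MvPolynomial.pderiv j q) •
        (ContinuousLinearMap.proj j : (Fin k → ℝ) →L[ℝ] ℝ)) s := by
  classical
  induction q using MvPolynomial.induction_on with
  | C a => simpa using hasFDerivAt_const a s
  | add p q hp hq =>
    simpa [add_smul, Finset.sum_add_distrib] using! hp.add hq
  | mul_X p i hp =>
    have h1 := hp.mul ((ContinuousLinearMap.proj i : (Fin k → ℝ) →L[ℝ] ℝ).hasFDerivAt (x := s))
    simp only [map_mul, MvPolynomial.eval_X]
    refine h1.congr_fderiv ?_
    ext v
    simp [Finset.sum_add_distrib, Finset.mul_sum, add_mul, Pi.single_apply, apply_ite,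
      MvPolynomial.pderiv_X]
    refine Finset.sum_congr rfl fun j _ => by ring

theorem eval_temperate {k : ℕ} (q : MvPolynomial (Fin k) ℝ) :
    Function.HasTemperateGrowth (fun s : Fin k → ℝ => MvPolynomial.eval s q) := by
  induction q using MvPolynomial.induction_on with
  | C a => simpa using Function.HasTemperateGrowth.const a
  | add p q hp hq => simpa using! hp.add hq
  | mul_X p i hp =>
    simpa using! hp.mul (ContinuousLinearMap.proj i : (Fin k → ℝ) →L[ℝ] ℝ).hasTemperateGrowth

variable {V : Type} [NormedAddCommGroup V] [NormedSpace ℝ V] {k : ℕ}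

theorem dens_integrable (ι : (Fin k → ℝ) →L[ℝ] V) (hι : Function.Injective ι)
    (q : MvPolynomial (Fin k) ℝ) (u : 𝓢(V, ℝ)) :
    Integrable (fun s : Fin k → ℝ => MvPolynomial.eval s q * u (ι s)) volume := by
  obtain ⟨r, hr⟩ := exists_restr ι hι u
  refine ((SchwartzMap.smulLeftCLM ℝ (fun s : Fin k → ℝ => MvPolynomial.eval s q) r).integrable
    (μ := volume)).congr (ae_of_all _ fun s => ?_)
  rw [SchwartzMap.smulLeftCLM_apply_apply (eval_temperate q), hr, smul_eq_mul]

/-- Directional derivative of Schwartz functions. -/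
def LD (a : V) : 𝓢(V, ℝ) →ₗ[ℝ] 𝓢(V, ℝ) :=
  (SchwartzMap.evalCLM ℝ V ℝ a ∘L SchwartzMap.fderivCLM ℝ V ℝ).toLinearMap

theorem LD_apply (a : V) (u : 𝓢(V, ℝ)) (x : V) : LD a u x = fderiv ℝ u x a := rfl

/-- Polynomial densities along `ι`. -/
def dk (ι : (Fin k → ℝ) →L[ℝ] V) (hι : Function.Injective ι) :
    MvPolynomial (Fin k) ℝ →ₗ[ℝ] 𝓢(V, ℝ) →ₗ[ℝ] ℝ :=
  LinearMap.mk₂ ℝ (fun q u => ∫ s : Fin k → ℝ, MvPolynomial.eval s q * u (ι s))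
    (fun p q u => by
      rw [← integral_add (dens_integrable ι hι p u) (dens_integrable ι hι q u)]
      simp [add_mul])
    (fun c q u => by
      rw [smul_eq_mul, ← integral_const_mul]
      simp [mul_assoc, MvPolynomial.smul_eval])
    (fun q u v => by
      rw [← integral_add (dens_integrable ι hι q u) (dens_integrable ι hι q v)]
      simp [mul_add])
    (fun c q u => by
      rw [smul_eq_mul, ← integral_const_mul]
      simp [mul_left_comm])

theorem dk_apply (ι : (Fin k → ℝ) →L[ℝ] V) (hι : Function.Injective ι)
    (q : MvPolynomial (Fin k) ℝ) (u : 𝓢(V, ℝ)) :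
    dk ι hι q u = ∫ s : Fin k → ℝ, MvPolynomial.eval s q * u (ι s) := rfl

theorem dk_ibp (ι : (Fin k → ℝ) →L[ℝ] V) (hι : Function.Injective ι)
    (q : MvPolynomial (Fin k) ℝ) (u : 𝓢(V, ℝ)) (j : Fin k) :
    dk ι hι (MvPolynomial.pderiv j q) u = - dk ι hι q (LD (ι (Pi.single j 1)) u) := by
  classical
  rw [dk_apply, dk_apply, eq_neg_iff_add_eq_zero, add_comm, ← eq_neg_iff_add_eq_zero]
  have hev : ∀ s, (∑ i, MvPolynomial.eval s (MvPolynomial.pderiv i q) •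
        (ContinuousLinearMap.proj i : (Fin k → ℝ) →L[ℝ] ℝ)) (Pi.single j 1) =
      MvPolynomial.eval s (MvPolynomial.pderiv j q) := by
    intro s
    simp [Pi.single_apply]
  have := integral_bilinear_hasFDerivAt_right_eq_neg_left_of_integrable
    (μ := (volume : Measure (Fin k → ℝ))) (v := Pi.single j 1)
    (B := ContinuousLinearMap.mul ℝ ℝ)
    (f := fun s : Fin k → ℝ => MvPolynomial.eval s q)
    (f' := fun s => (∑ i, MvPolynomial.eval s (MvPolynomial.pderiv i q) •
        (ContinuousLinearMap.proj i : (Fin k → ℝ) →L[ℝ] ℝ)))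
    (g := fun s => u (ι s)) (g' := fun s => (fderiv ℝ u (ι s)).comp ι)
    (by simp only [hev]; exact dens_integrable ι hι _ u)
    (dens_integrable ι hι q (LD (ι (Pi.single j 1)) u))
    (dens_integrable ι hι q u)
    (fun s _ => eval_hasFDerivAt q s)
    (fun s _ => (u.hasFDerivAt (ι s)).comp s ι.hasFDerivAt)
  simp only [hev] at this
  exact this

end polydens

section nondeg
open scoped SchwartzMap
variable {V : Type} [NormedAddCommGroup V] [NormedSpace ℝ V] [FiniteDimensional ℝ V] {k : ℕ}

theorem dk_nondeg (ι : (Fin k → ℝ) →L[ℝ] V) (hι : Function.Injective ι)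
    (q : MvPolynomial (Fin k) ℝ) (h : ∀ u, dk ι hι q u = 0) : q = 0 := by

  refine MvPolynomial.funext fun s₀ => ?_
  rw [map_zero]
  -- a left inverse of ι
  obtain ⟨π, hπ⟩ := ι.toLinearMap.exists_leftInverse_of_injective (LinearMap.ker_eq_bot.2 hι)
  let π' : V →L[ℝ] (Fin k → ℝ) := LinearMap.toContinuousLinearMap π
  have hπ' : ∀ s, π' (ι s) = s := fun s => congrArg (fun f => f s) hπ
  let b : ContDiffBump (ι s₀) := ⟨1, 2, by norm_num, by norm_num⟩
  have hb : ContDiff ℝ (⊤ : ℕ∞) (b : V → ℝ) := b.contDiff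
  let u0 : 𝓢(V, ℝ) := b.hasCompactSupport.toSchwartzMap hb
  have hu0 : ∀ x, u0 x = b x := fun x => rfl
  have ht : Function.HasTemperateGrowth (fun x : V => MvPolynomial.eval (π' x) q) :=
    (eval_temperate q).comp π'.hasTemperateGrowth
  let u : 𝓢(V, ℝ) := SchwartzMap.smulLeftCLM ℝ (fun x : V => MvPolynomial.eval (π' x) q) u0
  have hu : ∀ s, u (ι s) = MvPolynomial.eval s q * b (ι s) := by
    intro s
    simp only [u]
    rw [SchwartzMap.smulLeftCLM_apply_apply ht, hπ', hu0, smul_eq_mul]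
  have h1 := h u
  have hIntg := dens_integrable ι hι q u
  rw [dk_apply] at h1
  have hnn : 0 ≤ fun s : Fin k → ℝ => MvPolynomial.eval s q * u (ι s) := by
    intro s
    simp only [hu, Pi.zero_apply]
    have := b.nonneg (x := ι s)
    rw [← mul_assoc]
    exact mul_nonneg (mul_self_nonneg _) this
  have h2 := (integral_eq_zero_iff_of_nonneg hnn hIntg).1 h1
  have hc : Continuous fun s : Fin k → ℝ => MvPolynomial.eval s q * u (ι s) := by
    have := (MvPolynomial.continuous_eval q)
    have := u.continuous
    fun_prop
  have h3 := congrFun ((hc.ae_eq_iff_eq volume (continuous_const (y := (0:ℝ)))).1 h2) s₀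
  have hb1 : b (ι s₀) = 1 := b.one_of_mem_closedBall (by simp [b])
  simpa [hu, hb1] using h3

theorem exists_unit (ι : (Fin k → ℝ) →L[ℝ] V) (hι : Function.Injective ι) :
    ∃ η : 𝓢(V, ℝ), ∫ s, η (ι s) ≠ 0 := by
  by_contra! hcon
  have := dk_nondeg ι hι 1 (fun u => by rw [dk_apply]; simpa using hcon u)
  exact one_ne_zero this

end nondeg

section poincare

theorem poincare {k : ℕ} (q : Fin k → MvPolynomial (Fin k) ℝ)
    (hq : ∀ i j, MvPolynomial.pderiv i (q j) = MvPolynomial.pderiv j (q i)) :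
    ∃ p : MvPolynomial (Fin k) ℝ, ∀ i, MvPolynomial.pderiv i p = q i := by
  classical
  -- homogeneous components are compatible
  have hcomp : ∀ (d : ℕ) (i : Fin k) (r : MvPolynomial (Fin k) ℝ),
      MvPolynomial.pderiv i (MvPolynomial.homogeneousComponent (d + 1) r) =
        MvPolynomial.homogeneousComponent d (MvPolynomial.pderiv i r) := by
    intro d i r
    ext m
    rw [MvPolynomial.coeff_pderiv, MvPolynomial.coeff_homogeneousComponent,
      MvPolynomial.coeff_homogeneousComponent, MvPolynomial.coeff_pderiv]
    simp [map_add, ite_mul]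
  have hcomp0 : ∀ (i : Fin k) (r : MvPolynomial (Fin k) ℝ),
      MvPolynomial.pderiv i (MvPolynomial.homogeneousComponent 0 r) = 0 := by
    intro i r; simp [MvPolynomial.homogeneousComponent_zero]
  have hsym : ∀ (d : ℕ) (i j : Fin k),
      MvPolynomial.pderiv i (MvPolynomial.homogeneousComponent d (q j)) =
      MvPolynomial.pderiv j (MvPolynomial.homogeneousComponent d (q i)) := by
    intro d i j
    cases d with
    | zero => rw [hcomp0, hcomp0]
    | succ d => rw [hcomp, hcomp, hq]
  have hbig : ∃ N, ∀ j, (q j).totalDegree < N := by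
    refine ⟨∑ j, (q j).totalDegree + 1, fun j => Nat.lt_succ_of_le ?_⟩
    exact Finset.single_le_sum (f := fun j => (q j).totalDegree) (fun _ _ => Nat.zero_le _) (Finset.mem_univ j)
  obtain ⟨N, hN⟩ := hbig
  refine ⟨∑ d ∈ Finset.range N, ((d + 1 : ℝ)⁻¹) • ∑ j, MvPolynomial.X j *
    MvPolynomial.homogeneousComponent d (q j), fun i => ?_⟩
  have hsum : q i = ∑ d ∈ Finset.range N, MvPolynomial.homogeneousComponent d (q i) := by
    conv_lhs => rw [← MvPolynomial.sum_homogeneousComponent (q i)]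
    refine Finset.sum_subset (fun x hx => ?_) (fun d _ hd => ?_)
    · have := hN i; simp at hx ⊢; omega
    · exact MvPolynomial.homogeneousComponent_eq_zero _ _ (by simpa using hd)
  rw [map_sum]
  conv_rhs => rw [hsum]
  refine Finset.sum_congr rfl fun d _ => ?_
  have hE := (MvPolynomial.homogeneousComponent_isHomogeneous d (q i)).sum_X_mul_pderiv
  rw [Derivation.map_smul, map_sum]
  have : ∀ j, MvPolynomial.pderiv i (MvPolynomial.X j * MvPolynomial.homogeneousComponent d (q j))
      = (Pi.single i 1 : Fin k → MvPolynomial (Fin k) ℝ) j * MvPolynomial.homogeneousComponent d (q j) +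
        MvPolynomial.X j * MvPolynomial.pderiv j (MvPolynomial.homogeneousComponent d (q i)) := by
    intro j
    rw [MvPolynomial.pderiv_mul, hsym d i j, MvPolynomial.pderiv_X]
  simp_rw [this]
  rw [Finset.sum_add_distrib, hE]
  have h1 : ∑ j, (Pi.single i 1 : Fin k → MvPolynomial (Fin k) ℝ) j *
      MvPolynomial.homogeneousComponent d (q j) = MvPolynomial.homogeneousComponent d (q i) := by
    simp [Pi.single_apply]
  rw [h1]
  have hd : (d + 1 : ℝ) ≠ 0 := by positivity
  rw [inv_smul_eq_iff₀ hd, add_smul, one_smul, add_comm, Nat.cast_smul_eq_nsmul]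
end poincare

section functional
open scoped SchwartzMap
variable {V : Type} [NormedAddCommGroup V] [NormedSpace ℝ V] {k : ℕ}

/-- Distributional derivative on linear functionals. -/
def dl (a : V) : Module.End ℝ (𝓢(V, ℝ) →ₗ[ℝ] ℝ) := -(LinearMap.lcomp ℝ ℝ (LD a))

theorem dl_apply (a : V) (g : 𝓢(V, ℝ) →ₗ[ℝ] ℝ) (u : 𝓢(V, ℝ)) : dl a g u = - g (LD a u) := rfl

theorem LD_comm (a b : V) (u : 𝓢(V, ℝ)) : LD a (LD b u) = LD b (LD a u) := by
  have key : ∀ (a b x : V), LD a (LD b u) x = fderiv ℝ (fderiv ℝ u) x a b := by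
    intro a b x
    have h1 : HasFDerivAt (fderiv ℝ u) (fderiv ℝ (fderiv ℝ u) x) x :=
      (SchwartzMap.fderivCLM ℝ V ℝ u).hasFDerivAt x
    have h2 : HasFDerivAt (fun y => fderiv ℝ u y b)
        ((fderiv ℝ (fderiv ℝ u) x).flip b) x := by
      simpa using h1.clm_apply (hasFDerivAt_const b x)
    rw [LD_apply]
    have h3 : (LD b u : V → ℝ) = fun y => fderiv ℝ u y b := rfl
    rw [h3, h2.fderiv]; rfl
  ext x
  rw [key, key]
  have hs : IsSymmSndFDerivAt ℝ u x :=
    ((u.smooth 2).contDiffAt (x := x)).isSymmSndFDerivAt (by simp)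
  exact hs a b

theorem dl_comm (a b : V) : Commute (dl a) (dl b) := by
  refine LinearMap.ext fun g => LinearMap.ext fun u => ?_
  change dl a (dl b g) u = dl b (dl a g) u
  simp only [dl_apply, LD_comm a b]

theorem LD_add (a b : V) : LD (a + b) = LD a + LD b := by
  refine LinearMap.ext fun u => ?_
  ext x
  change fderiv ℝ u x (a + b) = fderiv ℝ u x a + fderiv ℝ u x b
  simp

theorem LD_smul (c : ℝ) (a : V) : LD (c • a) = c • LD a := by
  refine LinearMap.ext fun u => ?_
  ext x
  change fderiv ℝ u x (c • a) = c • fderiv ℝ u x a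
  simp

/-- `dl` is linear in the direction. -/
def dlL : V →ₗ[ℝ] Module.End ℝ (𝓢(V, ℝ) →ₗ[ℝ] ℝ) where
  toFun := dl
  map_add' a b := by
    refine LinearMap.ext fun g => LinearMap.ext fun u => ?_
    change - g (LD (a + b) u) = - g (LD a u) + - g (LD b u)
    rw [LD_add]; simp; ring
  map_smul' c a := by
    refine LinearMap.ext fun g => LinearMap.ext fun u => ?_
    change - g (LD (c • a) u) = c * - g (LD a u)
    rw [LD_smul]; simp

/-- The functional only depends on the restriction along `ι`. -/
def Supp (ι : (Fin k → ℝ) →L[ℝ] V) (g : 𝓢(V, ℝ) →ₗ[ℝ] ℝ) : Prop :=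
  ∀ u v : 𝓢(V, ℝ), (∀ s, u (ι s) = v (ι s)) → g u = g v

theorem Supp.dl {ι : (Fin k → ℝ) →L[ℝ] V} {g : 𝓢(V, ℝ) →ₗ[ℝ] ℝ} (h : Supp ι g) (c : Fin k → ℝ) :
    Supp ι (dl (ι c) g) := by
  intro u v huv
  rw [dl_apply, dl_apply]
  congr 1
  refine h _ _ fun s => ?_
  have hu : HasFDerivAt (fun s => u (ι s)) ((fderiv ℝ u (ι s)).comp ι) s :=
    (u.hasFDerivAt (ι s)).comp s ι.hasFDerivAt
  have hv : HasFDerivAt (fun s => v (ι s)) ((fderiv ℝ v (ι s)).comp ι) s :=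
    (v.hasFDerivAt (ι s)).comp s ι.hasFDerivAt
  rw [show (fun s => u (ι s)) = fun s => v (ι s) from funext huv] at hu
  exact congrArg (fun L => L c) (hu.unique hv)

theorem dl_dk (ι : (Fin k → ℝ) →L[ℝ] V) (hι : Function.Injective ι)
    (q : MvPolynomial (Fin k) ℝ) (j : Fin k) :
    dl (ι (Pi.single j 1)) (dk ι hι q) = dk ι hι (MvPolynomial.pderiv j q) := by
  refine LinearMap.ext fun u => ?_
  rw [dk_ibp, dl_apply]

theorem supp_dk (ι : (Fin k → ℝ) →L[ℝ] V) (hι : Function.Injective ι)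
    (q : MvPolynomial (Fin k) ℝ) : Supp ι (dk ι hι q) := by
  intro u v huv
  simp [dk_apply, huv]

variable [FiniteDimensional ℝ V]

theorem dk_injective (ι : (Fin k → ℝ) →L[ℝ] V) (hι : Function.Injective ι) :
    Function.Injective (dk ι hι) := by
  refine (injective_iff_map_eq_zero _).2 fun q hq => dk_nondeg ι hι q fun u => ?_
  rw [hq]; rfl

theorem const_of_dl_zero (ι : (Fin k → ℝ) →L[ℝ] V) (hι : Function.Injective ι)
    (g : 𝓢(V, ℝ) →ₗ[ℝ] ℝ) (hg : Supp ι g) (h0 : ∀ j, dl (ι (Pi.single j 1)) g = 0) :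
    ∃ p, g = dk ι hι p := by
  obtain ⟨η, hη⟩ := exists_unit ι hι
  refine ⟨MvPolynomial.C (g η / ∫ s, η (ι s)), LinearMap.ext fun u => ?_⟩
  obtain ⟨h, hh⟩ := exists_div2 ι hι u η
  have h1 : g (∑ j, LD (ι (Pi.single j 1)) (h j)) =
      g ((∫ s, u (ι s)) • η - (∫ s, η (ι s)) • u) := by
    refine hg _ _ fun s => ?_
    have := hh s
    simpa [sum_apply, LD_apply] using this
  have h2 : g (∑ j, LD (ι (Pi.single j 1)) (h j)) = 0 := by
    rw [map_sum]
    refine Finset.sum_eq_zero fun j _ => ?_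
    have := congrArg (fun G => G (h j)) (h0 j)
    simpa [dl_apply] using this
  rw [h2, map_sub, map_smul, map_smul, smul_eq_mul, smul_eq_mul] at h1
  rw [dk_apply]
  simp only [MvPolynomial.eval_C]
  rw [integral_const_mul]
  field_simp
  linarith

theorem poly_of_dl_poly (ι : (Fin k → ℝ) →L[ℝ] V) (hι : Function.Injective ι)
    (g : 𝓢(V, ℝ) →ₗ[ℝ] ℝ) (hg : Supp ι g)
    (h : ∀ j, ∃ q, dl (ι (Pi.single j 1)) g = dk ι hι q) :
    ∃ p, g = dk ι hι p := by
  choose q hq using h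
  obtain ⟨p, hp⟩ := poincare q fun i j => by
    apply dk_injective ι hι
    rw [← dl_dk, ← dl_dk, ← hq, ← hq]
    exact congrArg (fun L => L g) (dl_comm (ι (Pi.single i 1)) (ι (Pi.single j 1))).eq
  obtain ⟨c, hc⟩ := const_of_dl_zero ι hι (g - dk ι hι p)
    (fun u v huv => by
      rw [LinearMap.sub_apply, LinearMap.sub_apply, hg u v huv, supp_dk ι hι p u v huv])
    (fun j => by rw [map_sub, hq, dl_dk, hp, sub_self])
  exact ⟨c + p, by rw [map_add, ← hc]; abel⟩

/-- Iterated derivative on functionals. -/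
def it {m : ℕ} (X : Fin m → V) (S : Finset (Fin m)) : Module.End ℝ (𝓢(V, ℝ) →ₗ[ℝ] ℝ) :=
  (S.toList.map fun i => dl (X i)).prod

theorem it_insert {m : ℕ} (X : Fin m → V) (S : Finset (Fin m)) (a : Fin m) (ha : a ∉ S) :
    it X (insert a S) = it X S * dl (X a) := by
  have hp := (Finset.toList_insert ha).map fun i => dl (X i)
  have hc : ∀ l : List (Fin m), Commute (dl (X a)) (l.map fun i => dl (X i)).prod := by
    intro l
    refine Commute.list_prod_right _ _ fun y hy => ?_
    obtain ⟨b, -, rfl⟩ := List.mem_map.1 hy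
    exact dl_comm _ _
  unfold it
  rw [hp.prod_eq' ?_, List.map_cons, List.prod_cons, (hc S.toList).eq]
  refine List.pairwise_of_forall_mem_list fun x hx y hy => ?_
  obtain ⟨b, -, rfl⟩ := List.mem_map.1 hx
  obtain ⟨c, -, rfl⟩ := List.mem_map.1 hy
  exact dl_comm _ _

theorem it_union {m : ℕ} (X : Fin m → V) (S S' : Finset (Fin m)) (h : Disjoint S S') :
    it X (S ∪ S') = it X S * it X S' := by
  induction S' using Finset.induction_on with
  | empty => simp [it]
  | insert a s ha ih =>
    rw [Finset.disjoint_insert_right] at h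
    rw [Finset.union_insert, it_insert _ _ _ (by simp [h.1, ha]), it_insert _ _ _ ha, ih h.2, mul_assoc]

theorem poly_induct {m : ℕ} (X : Fin m → V) (ι : (Fin k → ℝ) →L[ℝ] V) (hι : Function.Injective ι)
    (S : Finset (Fin m)) : (∀ i ∈ S, X i ∈ LinearMap.range ι.toLinearMap) →
    ∀ g : 𝓢(V, ℝ) →ₗ[ℝ] ℝ, Supp ι g →
    (∀ A ⊆ S, Submodule.span ℝ (X '' A) ≠ LinearMap.range ι.toLinearMap → it X (S \ A) g = 0) →
    ∃ p, g = dk ι hι p := by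
  induction S using Finset.strongInduction with
  | H S ih =>
  intro hS g hg h
  by_cases hsp : Submodule.span ℝ (X '' S) = LinearMap.range ι.toLinearMap
  swap
  · refine ⟨0, ?_⟩
    have := h S subset_rfl hsp
    simpa [it] using this
  have h1 : ∀ a ∈ S, ∃ q, dl (X a) g = dk ι hι q := by
    intro a ha
    refine ih (S.erase a) (Finset.erase_ssubset ha) (fun i hi => hS i (Finset.mem_of_mem_erase hi))
      _ ?_ ?_
    · obtain ⟨c, hc⟩ := hS a ha
      rw [← hc]
      exact hg.dl c
    · intro A hA hspA
      have haA : a ∉ A := fun h => by simpa using hA h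
      have := h A (hA.trans (Finset.erase_subset _ _)) hspA
      have he : S \ A = insert a (S.erase a \ A) := by
        ext i; by_cases hi : i = a <;> simp_all
      rw [he, it_insert _ _ _ (by simp)] at this
      exact this
  refine poly_of_dl_poly ι hι g hg fun j => ?_
  have hmem : ι (Pi.single j 1) ∈ Submodule.span ℝ (X '' S) := by
    rw [hsp]; exact ⟨_, rfl⟩
  generalize ι (Pi.single j 1) = y at hmem
  induction hmem using Submodule.span_induction with
  | mem x hx =>
    obtain ⟨a, ha, rfl⟩ := hx
    exact h1 a ha
  | zero => exact ⟨0, by rw [map_zero]; exact congrArg (fun L => L g) (map_zero (dlL (V := V)))⟩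
  | add x y _ _ hx hy =>
    obtain ⟨p, hp⟩ := hx
    obtain ⟨q, hq⟩ := hy
    refine ⟨p + q, ?_⟩
    rw [map_add, ← hp, ← hq]
    exact congrArg (fun L => L g) (map_add (dlL (V := V)) x y)
  | smul c x _ hx =>
    obtain ⟨p, hp⟩ := hx
    refine ⟨c • p, ?_⟩
    rw [map_smul, ← hp]
    exact congrArg (fun L => L g) (map_smul (dlL (V := V)) c x)

end functional

section final
open scoped SchwartzMap

/-- The parametrization of `W` by coordinates in the standard orthonormal basis. -/
def par {n : ℕ} (W : Submodule ℝ (Vg n)) :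
    (Fin (Module.finrank ℝ W) → ℝ) →L[ℝ] Vg n :=
  LinearMap.toContinuousLinearMap
    (W.subtype ∘ₗ Fintype.linearCombination ℝ (fun j => stdOrthonormalBasis ℝ W j))

theorem par_apply {n : ℕ} (W : Submodule ℝ (Vg n)) (s : Fin (Module.finrank ℝ W) → ℝ) :
    par W s = ((∑ j, s j • stdOrthonormalBasis ℝ W j : W) : Vg n) := rfl

theorem par_single {n : ℕ} (W : Submodule ℝ (Vg n)) (j : Fin (Module.finrank ℝ W)) :
    par W (Pi.single j 1) = (stdOrthonormalBasis ℝ W j : Vg n) := by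
  classical
  rw [par_apply]
  congr 1
  simp [Pi.single_apply]

theorem inner_par {n : ℕ} (W : Submodule ℝ (Vg n)) (s : Fin (Module.finrank ℝ W) → ℝ)
    (j : Fin (Module.finrank ℝ W)) :
    ∑ i, (stdOrthonormalBasis ℝ W j : Vg n) i * par W s i = s j := by
  have h1 : inner ℝ (stdOrthonormalBasis ℝ W j) (∑ l, s l • stdOrthonormalBasis ℝ W l) = s j := by
    rw [(stdOrthonormalBasis ℝ W).orthonormal.inner_right_fintype]
  rw [Submodule.coe_inner, PiLp.inner_apply] at h1
  rw [← h1, par_apply]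
  refine Finset.sum_congr rfl fun i _ => ?_
  simp [mul_comm]

theorem par_inj {n : ℕ} (W : Submodule ℝ (Vg n)) : Function.Injective (par W) := by
  intro s t h
  funext j
  rw [← inner_par W s j, ← inner_par W t j, h]

theorem par_range {n : ℕ} (W : Submodule ℝ (Vg n)) :
    LinearMap.range (par W).toLinearMap = W := by
  ext x
  constructor
  · rintro ⟨s, rfl⟩
    exact Subtype.property _
  · intro hx
    refine ⟨fun j => (stdOrthonormalBasis ℝ W).repr ⟨x, hx⟩ j, ?_⟩
    change par W _ = x
    rw [par_apply, (stdOrthonormalBasis ℝ W).sum_repr]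

/-- Pullback of polynomials to coordinates on `W`. -/
def pb {n : ℕ} (W : Submodule ℝ (Vg n)) :
    MvPolynomial (Fin n) ℝ →ₐ[ℝ] MvPolynomial (Fin (Module.finrank ℝ W)) ℝ :=
  MvPolynomial.aeval fun i => ∑ j, (stdOrthonormalBasis ℝ W j : Vg n) i • MvPolynomial.X j

/-- Extension of polynomials on `W` to the whole space. -/
def lft {n : ℕ} (W : Submodule ℝ (Vg n)) :
    MvPolynomial (Fin (Module.finrank ℝ W)) ℝ →ₐ[ℝ] MvPolynomial (Fin n) ℝ :=
  MvPolynomial.aeval fun j => ∑ i, (stdOrthonormalBasis ℝ W j : Vg n) i • MvPolynomial.X i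

theorem eval_pb {n : ℕ} (W : Submodule ℝ (Vg n)) (p : MvPolynomial (Fin n) ℝ)
    (s : Fin (Module.finrank ℝ W) → ℝ) :
    MvPolynomial.eval s (pb W p) = evalP p (par W s) := by
  unfold evalP
  induction p using MvPolynomial.induction_on with
  | C a => simp [pb]
  | add p q hp hq => rw [map_add, map_add, map_add, hp, hq]
  | mul_X p i hp =>
    rw [map_mul, map_mul, map_mul, hp]
    congr 1
    simp [pb, MvPolynomial.smul_eval, par_apply, mul_comm]

theorem eval_lft {n : ℕ} (W : Submodule ℝ (Vg n)) (q : MvPolynomial (Fin (Module.finrank ℝ W)) ℝ)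
    (s : Fin (Module.finrank ℝ W) → ℝ) :
    evalP (lft W q) (par W s) = MvPolynomial.eval s q := by
  unfold evalP
  induction q using MvPolynomial.induction_on with
  | C a => simp [lft]
  | add p q hp hq => rw [map_add, map_add, map_add, hp, hq]
  | mul_X p i hp =>
    rw [map_mul, map_mul, map_mul, hp]
    congr 1
    simpa [lft, MvPolynomial.smul_eval] using inner_par W s i

theorem pb_lft {n : ℕ} (W : Submodule ℝ (Vg n)) (q : MvPolynomial (Fin (Module.finrank ℝ W)) ℝ) :
    pb W (lft W q) = q :=
  MvPolynomial.funext fun s => by rw [eval_pb, eval_lft]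

theorem pdirD_apply {n : ℕ} (a : Vg n) (p : MvPolynomial (Fin n) ℝ) :
    pdirD a p = ∑ i, a i • MvPolynomial.pderiv i p := by
  simp [pdirD, LinearMap.sum_apply]

theorem pb_pdirD {n : ℕ} (W : Submodule ℝ (Vg n)) (p : MvPolynomial (Fin n) ℝ)
    (c : Fin (Module.finrank ℝ W) → ℝ) :
    pb W (pdirD (par W c) p) = ∑ j, c j • MvPolynomial.pderiv j (pb W p) := by
  classical
  induction p using MvPolynomial.induction_on with
  | C a => simp [pb, pdirD_apply]
  | add p q hp hq => simp [map_add, hp, hq, Finset.sum_add_distrib]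
  | mul_X p i hp =>
    have h1 : pdirD (par W c) (p * MvPolynomial.X i) =
        pdirD (par W c) p * MvPolynomial.X i + p * MvPolynomial.C (par W c i) := by
      simp only [pdirD_apply, MvPolynomial.pderiv_mul, smul_add, Finset.sum_add_distrib,
        Finset.sum_mul, MvPolynomial.pderiv_X, smul_mul_assoc]
      congr 1
      simp [Pi.single_apply, MvPolynomial.C_mul', MvPolynomial.smul_eq_C_mul, mul_comm]
    have h2 : ∑ j, c j • MvPolynomial.pderiv j (pb W (MvPolynomial.X i)) =
        MvPolynomial.C (par W c i) := by
      have : ∀ j, MvPolynomial.pderiv j (pb W (MvPolynomial.X i)) =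
          MvPolynomial.C ((stdOrthonormalBasis ℝ W j : Vg n) i) := by
        intro j
        simp [pb, MvPolynomial.smul_eq_C_mul, Pi.single_apply]
      simp_rw [this]
      simp [MvPolynomial.smul_eq_C_mul, par_apply]
    rw [h1, map_add, map_mul, map_mul, hp, map_mul, ← MvPolynomial.algebraMap_eq, AlgHom.commutes,
      MvPolynomial.algebraMap_eq, ← h2]
    simp only [MvPolynomial.pderiv_mul, smul_add, Finset.sum_add_distrib,
        Finset.sum_mul, Finset.mul_sum, smul_mul_assoc, mul_smul_comm]

theorem dl_dk_pb {n : ℕ} (W : Submodule ℝ (Vg n)) (p : MvPolynomial (Fin n) ℝ)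
    (a : Vg n) (ha : a ∈ W) :
    dl a (dk (par W) (par_inj W) (pb W p)) = dk (par W) (par_inj W) (pb W (pdirD a p)) := by
  rw [← par_range W] at ha
  obtain ⟨c, rfl⟩ := ha
  change dl (par W c) _ = dk (par W) (par_inj W) (pb W (pdirD (par W c) p))
  rw [pb_pdirD, map_sum]
  have hc : par W c = ∑ j, c j • par W (Pi.single j 1) := by
    conv_lhs => rw [show c = ∑ j, c j • (Pi.single j (1 : ℝ)) by simpa using pi_eq_sum_univ' c]
    rw [map_sum]; simp_rw [map_smul]
  change dlL (par W c) _ = _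
  rw [hc, map_sum, LinearMap.sum_apply]
  refine Finset.sum_congr rfl fun j _ => ?_
  rw [map_smul, map_smul, ← dl_dk]
  rfl

theorem it_dk_pb {n m : ℕ} (X : Fin m → Vg n) (W : Submodule ℝ (Vg n)) (p : MvPolynomial (Fin n) ℝ)
    (Z : Finset (Fin m)) (hZ : ∀ i ∈ Z, X i ∈ W) :
    it X Z (dk (par W) (par_inj W) (pb W p)) =
      dk (par W) (par_inj W) (pb W (piterD X Z p)) := by
  unfold it piterD
  have hl : ∀ i ∈ Z.toList, X i ∈ W := fun i hi => hZ i (Finset.mem_toList.1 hi)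
  generalize Z.toList = l at hl
  induction l with
  | nil => simp
  | cons a l ih =>
    simp only [List.map_cons, List.prod_cons, Module.End.mul_apply]
    rw [ih fun i hi => hl i (List.mem_cons_of_mem _ hi), dl_dk_pb _ _ _ (hl a List.mem_cons_self)]

theorem densOn_eq {n : ℕ} (W : Submodule ℝ (Vg n)) (p : MvPolynomial (Fin n) ℝ) (u : 𝓢(Vg n, ℝ)) :
    densOn W p ⇑u = dk (par W) (par_inj W) (pb W p) u := by
  rw [dk_apply]
  simp_rw [eval_pb]
  rfl

theorem iterD_eq {n m : ℕ} (X : Fin m → Vg n) (T : GDist n) (T' : 𝓢(Vg n, ℝ) →ₗ[ℝ] ℝ)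
    (hT : ∀ u : 𝓢(Vg n, ℝ), T ⇑u = T' u) (S : Finset (Fin m)) (u : 𝓢(Vg n, ℝ)) :
    iterD X S T ⇑u = it X S T' u := by
  unfold iterD it
  generalize S.toList = l
  induction l generalizing u with
  | nil => simpa using hT u
  | cons a l ih =>
    simp only [List.map_cons, List.prod_cons, Module.End.mul_apply, List.foldr_cons]
    rw [dl_apply, ← ih]
    rfl

theorem idxOut_split {n m : ℕ} (X : Fin m → Vg n) (H W : Submodule ℝ (Vg n)) (h : H ≤ W) :
    idxOut X H = (idxIn X W \ idxIn X H) ∪ idxOut X W ∧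
      Disjoint (idxIn X W \ idxIn X H) (idxOut X W) := by
  constructor
  · ext i
    have := @h (X i)
    simp only [idxOut, idxIn, Finset.mem_union, Finset.mem_sdiff, Finset.mem_filter,
      Finset.mem_univ, true_and]
    tauto
  · rw [Finset.disjoint_left]
    intro i
    simp only [idxOut, idxIn, Finset.mem_sdiff, Finset.mem_filter,
      Finset.mem_univ, true_and]
    tauto

theorem exists_hyperplane {n m : ℕ} (X : Fin m → Vg n) (W : Submodule ℝ (Vg n))
    (hW : RationalSub X W) (A : Finset (Fin m)) (hA : A ⊆ idxIn X W)
    (hsp : Submodule.span ℝ (X '' A) ≠ W) :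
    ∃ H : Submodule ℝ (Vg n), RationalSub X H ∧ H ≤ W ∧
      Module.finrank ℝ H + 1 = Module.finrank ℝ W ∧ A ⊆ idxIn X H := by
  classical
  have hmemIn : ∀ (i : Fin m) (U : Submodule ℝ (Vg n)), i ∈ idxIn X U ↔ X i ∈ U := by
    intro i U; simp [idxIn]
  obtain ⟨B, hB, hmax⟩ := Finset.exists_max_image
    ((idxIn X W).powerset.filter fun B => A ⊆ B ∧ Submodule.span ℝ (X '' B) ≠ W) Finset.card
    ⟨A, by simp [hA, hsp]⟩
  simp only [Finset.mem_filter, Finset.mem_powerset] at hB hmax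
  obtain ⟨hBW, hAB, hBsp⟩ := hB
  set H := Submodule.span ℝ (X '' B) with hH
  have hHW : H ≤ W := by
    rw [hH, Submodule.span_le]
    rintro _ ⟨i, hi, rfl⟩
    exact (hmemIn i W).1 (hBW hi)
  have hBH : ∀ i ∈ B, X i ∈ H := fun i hi => Submodule.subset_span ⟨i, hi, rfl⟩
  refine ⟨H, ?_, hHW, ?_, fun i hi => (hmemIn i H).2 (hBH i (hAB hi))⟩
  · apply le_antisymm
    · rw [hH, Submodule.span_le, ← hH]
      rintro _ ⟨i, hi, rfl⟩
      exact Submodule.subset_span ⟨⟨i, rfl⟩, hBH i hi⟩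
    · rw [Submodule.span_le]
      exact Set.inter_subset_right
  · -- there is an element of X in W but not in H
    have hex : ∃ i, X i ∈ W ∧ X i ∉ H := by
      by_contra! hcon
      apply hBsp
      apply le_antisymm hHW
      rw [hW, Submodule.span_le]
      rintro _ ⟨⟨i, rfl⟩, hi⟩
      exact hcon i hi
    obtain ⟨i, hiW, hiH⟩ := hex
    have hiB : i ∉ B := fun h => hiH (hBH i h)
    have hins : Submodule.span ℝ (X '' (insert i B : Finset (Fin m))) = W := by
      by_contra hne
      have := hmax (insert i B) ⟨Finset.insert_subset ((hmemIn i W).2 hiW) hBW,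
        hAB.trans (Finset.subset_insert _ _), hne⟩
      rw [Finset.card_insert_of_notMem hiB] at this
      omega
    have hlt : Module.finrank ℝ H < Module.finrank ℝ W :=
      Submodule.finrank_lt_finrank_of_lt (lt_of_le_of_ne hHW hBsp)
    have hsup : W = Submodule.span ℝ {X i} ⊔ H := by
      rw [← hins, Finset.coe_insert, Set.image_insert_eq, Submodule.span_insert]
    have h1 : Module.finrank ℝ W ≤ 1 + Module.finrank ℝ H := by
      rw [hsup]
      refine (Submodule.finrank_add_le_finrank_add_finrank _ _).trans ?_
      gcongr
      refine (finrank_span_le_card _).trans ?_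
      simp
    omega

end final

theorem stmt13 {n m : ℕ} (X : Fin m → Vg n)
    (hX0 : ∀ i, X i ≠ 0)
    (hspan : Submodule.span ℝ (Set.range X) = ⊤)
    (i : ℕ) (W : Submodule ℝ (Vg n))
    (hW : RationalSub X W) (hdim : Module.finrank ℝ W = i)
    (T : GDist n) (hT : T ∈ GXf X i)
    (hlin : ∀ (a : ℝ) (f g : SchwartzMap (Vg n) ℝ),
      T (a • ⇑f + ⇑g) = a * T ⇑f + T ⇑g) :
    ∃ p : MvPolynomial (Fin n) ℝ, DcondOn X W p ∧
      DEq (iterD X (idxOut X W) T) (densOn W p) := by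
  classical
  have hT0 : T (⇑(0 : SchwartzMap (Vg n) ℝ)) = 0 := by
    have := hlin 1 0 0
    have e : (1 : ℝ) • ⇑(0 : SchwartzMap (Vg n) ℝ) + ⇑(0 : SchwartzMap (Vg n) ℝ)
        = ⇑(0 : SchwartzMap (Vg n) ℝ) := by ext; simp
    rw [e] at this
    linarith
  let T' : SchwartzMap (Vg n) ℝ →ₗ[ℝ] ℝ :=
    { toFun := fun u => T ⇑u
      map_add' := fun u v => by
        have := hlin 1 u v
        rw [one_smul, one_mul] at this
        exact this
      map_smul' := fun c u => by
        have := hlin c u 0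
        rw [hT0] at this
        have e : c • ⇑u + ⇑(0 : SchwartzMap (Vg n) ℝ) = ⇑(c • u) := by ext; simp
        rw [e] at this
        simpa using this }
  have hT' : ∀ u : SchwartzMap (Vg n) ℝ, T ⇑u = T' u := fun u => rfl
  obtain ⟨hG, hF⟩ := hT
  set g := it X (idxOut X W) T' with hg
  have hmemIn : ∀ (i : Fin m) (U : Submodule ℝ (Vg n)), i ∈ idxIn X U ↔ X i ∈ U := by
    intro i U; simp [idxIn]
  -- vanishing of the cocircuit derivatives of g
  have hcoc : ∀ H : Submodule ℝ (Vg n), RationalSub X H → H ≤ W →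
      Module.finrank ℝ H + 1 = Module.finrank ℝ W → it X (idxIn X W \ idxIn X H) g = 0 := by
    intro H hH hHW hfr
    obtain ⟨h1, h2⟩ := idxOut_split X H W hHW
    have h3 := hF H hH (by rw [hfr, hdim])
    refine LinearMap.ext fun u => ?_
    have h4 := h3 u
    rw [iterD_eq X T T' hT', h1, it_union _ _ _ h2] at h4
    exact h4
  have hsupp : Supp (par W) g := by
    intro u v huv
    have h1 := hG W hW u v fun w => by
      have hw : (w : Vg n) ∈ LinearMap.range (par W).toLinearMap := by
        rw [par_range]; exact w.2
      obtain ⟨s, hs⟩ := hw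
      rw [← hs]
      exact huv s
    rw [iterD_eq X T T' hT', iterD_eq X T T' hT'] at h1
    exact h1
  obtain ⟨q, hq⟩ := poly_induct X (par W) (par_inj W) (idxIn X W)
    (fun i hi => by rw [par_range]; exact (hmemIn i W).1 hi) g hsupp (by
      intro A hA hsp
      rw [par_range] at hsp
      obtain ⟨H, hH, hHW, hfr, hAH⟩ := exists_hyperplane X W hW A hA hsp
      have hHin : idxIn X H ⊆ idxIn X W := fun i hi =>
        (hmemIn i W).2 (hHW ((hmemIn i H).1 hi))
      have he : idxIn X W \ A = (idxIn X H \ A) ∪ (idxIn X W \ idxIn X H) := by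
        ext i
        have := @hAH i
        have := @hHin i
        simp only [Finset.mem_sdiff, Finset.mem_union]
        tauto
      have hdj : Disjoint (idxIn X H \ A) (idxIn X W \ idxIn X H) := by
        rw [Finset.disjoint_left]
        intro i h1 h2
        exact (Finset.mem_sdiff.1 h2).2 (Finset.mem_sdiff.1 h1).1
      rw [he, it_union _ _ _ hdj, Module.End.mul_apply, hcoc H hH hHW hfr, map_zero])
  refine ⟨lft W q, ?_, fun u => ?_⟩
  · rintro Z ⟨H, hH, hHW, hfr, rfl⟩ w
    have h1 := hcoc H hH hHW hfr
    rw [hq, ← pb_lft W q, it_dk_pb X W (lft W q) _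
      (fun i hi => (hmemIn i W).1 (Finset.mem_sdiff.1 hi).1)] at h1
    have h2 := dk_injective (par W) (par_inj W) (h1.trans (map_zero _).symm)
    have hw : (w : Vg n) ∈ LinearMap.range (par W).toLinearMap := by
      rw [par_range]; exact w.2
    obtain ⟨s, hs⟩ := hw
    have h3 : par W s = (w : Vg n) := hs
    rw [← h3, ← eval_pb, h2, map_zero]
  · rw [iterD_eq X T T' hT', densOn_eq, pb_lft, ← hq]
end
end

section
/- Leibniz-type identity for splines: for rational subspaces t̲ and r̲ and g ∈ D(X∩r̲), one has ∂_{X∖t̲}( T^{F_{r̲}}_{X∖r̲} * g ) = ( ∂_{(X∖t̲)∖r̲} T^{F_{r̲}}_{X∖r̲} ) * ( ∂_{(X∩r̲)∖(t̲∩r̲)} g ). In particular, if t̲ does not contain r̲ then ∂_{X∖t̲}( T^{F_{r̲}}_{X∖r̲} * g ) = 0. -/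
/-!
STATEMENT 14: Leibniz-type identity for splines: for rational subspaces t̲, r̲
and g ∈ D(X∩r̲),
∂_{X∖t̲}( T^{F_{r̲}}_{X∖r̲} * g )
  = ( ∂_{(X∖t̲)∖r̲} T^{F_{r̲}}_{X∖r̲} ) * ( ∂_{(X∩r̲)∖(t̲∩r̲)} g ).
In particular, if t̲ does not contain r̲ then ∂_{X∖t̲}( T^{F_{r̲}}_{X∖r̲} * g ) = 0.
-/

noncomputable section

open scoped BigOperators
open MeasureTheory

open SchwartzMap LineDeriv in
/-- Iterated line derivative of a Schwartz function along a list. -/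
def DL {n m : ℕ} (X : Fin m → Vg n) (l : List (Fin m)) (f : SchwartzMap (Vg n) ℝ) :
    SchwartzMap (Vg n) ℝ :=
  l.foldl (fun f i => lineDerivOp (X i) f) f

lemma lineDeriv_coe {n : ℕ} (a : Vg n) (f : SchwartzMap (Vg n) ℝ) :
    (fun x => fderiv ℝ f x a) = ⇑(LineDeriv.lineDerivOp a f) := by
  funext x
  rw [SchwartzMap.lineDerivOp_apply_eq_fderiv]

lemma lineDeriv_comm' {n : ℕ} (a b : Vg n) (f : SchwartzMap (Vg n) ℝ) :
    LineDeriv.lineDerivOp a (LineDeriv.lineDerivOp b f) =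
      LineDeriv.lineDerivOp b (LineDeriv.lineDerivOp a f) := by
  ext x
  have key : ∀ a b : Vg n, LineDeriv.lineDerivOp a (LineDeriv.lineDerivOp b f) x
      = fderiv ℝ (fderiv ℝ f) x a b := by
    intro a b
    rw [SchwartzMap.lineDerivOp_apply_eq_fderiv, ← lineDeriv_coe]
    have hd : DifferentiableAt ℝ (fderiv ℝ f) x :=
      ((f.smooth 2).fderiv_right (m := 1) (by norm_num)).differentiable (by norm_num) x
    rw [fderiv_clm_apply hd (differentiableAt_const b)]
    simp
  rw [key, key]
  have := (f.smooth 2).contDiffAt (x := x) |>.isSymmSndFDerivAt (by simp)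
  exact this a b

lemma DL_perm {n m : ℕ} (X : Fin m → Vg n) {l l' : List (Fin m)} (h : l.Perm l')
    (f : SchwartzMap (Vg n) ℝ) : DL X l f = DL X l' f := by
  unfold DL
  exact h.foldl_eq' (fun x _ y _ z => lineDeriv_comm' _ _ _) f

lemma foldr_eq {n m : ℕ} (X : Fin m → Vg n) (T : GDist n) (l : List (Fin m))
    (f : SchwartzMap (Vg n) ℝ) :
    l.foldr (fun i T => dirD (X i) T) T ⇑f = (-1) ^ l.length * T (DL X l f) := by
  induction l generalizing f with
  | nil => simp [DL]
  | cons i l ih =>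
    rw [List.foldr_cons]
    change - (l.foldr (fun i T => dirD (X i) T) T) (fun x => fderiv ℝ f x (X i)) = _
    rw [lineDeriv_coe, ih]
    simp [DL, pow_succ]

/-- The linear parametrisation of `W`. -/
def parL {n : ℕ} (W : Submodule ℝ (Vg n)) : (Fin (Module.finrank ℝ W) → ℝ) →ₗ[ℝ] Vg n :=
  W.subtype ∘ₗ (Fintype.linearCombination ℝ (stdOrthonormalBasis ℝ W))

lemma parL_apply {n : ℕ} (W : Submodule ℝ (Vg n)) (t) :
    parL W t = ((∑ j, t j • stdOrthonormalBasis ℝ W j : W) : Vg n) := rfl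

lemma parL_mem {n : ℕ} (W : Submodule ℝ (Vg n)) (t) : parL W t ∈ W := by
  rw [parL_apply]; exact Subtype.mem _

lemma parL_surj {n : ℕ} (W : Submodule ℝ (Vg n)) {a} (ha : a ∈ W) : ∃ t, parL W t = a := by
  refine ⟨fun j => (stdOrthonormalBasis ℝ W).repr ⟨a, ha⟩ j, ?_⟩
  rw [parL_apply, (stdOrthonormalBasis ℝ W).sum_repr]

lemma parL_inj {n : ℕ} (W : Submodule ℝ (Vg n)) : LinearMap.ker (parL W) = ⊥ := by
  rw [LinearMap.ker_eq_bot]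
  have h := (stdOrthonormalBasis ℝ W).toBasis.linearIndependent
  rw [OrthonormalBasis.coe_toBasis] at h
  have := h.fintypeLinearCombination_injective
  exact (Submodule.injective_subtype W).comp this

lemma densOn_eq_s14 {n : ℕ} (W : Submodule ℝ (Vg n)) (p : MvPolynomial (Fin n) ℝ) (f : Vg n → ℝ) :
    densOn W p f = ∫ t, evalP p (parL W t) * f (parL W t) := rfl

lemma pdirD_add {n : ℕ} (a : Vg n) (p q) : pdirD a (p + q) = pdirD a p + pdirD a q := map_add _ _ _

/-- `pdirD` as a derivation. -/
def pder {n : ℕ} (a : Vg n) : Derivation ℝ (MvPolynomial (Fin n) ℝ) (MvPolynomial (Fin n) ℝ) :=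
  ∑ i, a i • MvPolynomial.pderiv i

lemma pder_apply {n : ℕ} (a : Vg n) (p) : pder a p = ∑ i, a i • MvPolynomial.pderiv i p := by
  have := congrFun (map_sum (Derivation.coeFnAddMonoidHom (R := ℝ)
    (A := MvPolynomial (Fin n) ℝ) (M := MvPolynomial (Fin n) ℝ))
    (fun i => a i • MvPolynomial.pderiv i) Finset.univ) p
  rw [Finset.sum_apply] at this
  exact this

lemma pdirD_eq {n : ℕ} (a : Vg n) (p) : pdirD a p = pder a p := by
  simp [pdirD, pder_apply, LinearMap.sum_apply]

lemma pder_X {n : ℕ} (a : Vg n) (i : Fin n) :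
    pder a (MvPolynomial.X i) = MvPolynomial.C (a i) := by
  simp [pder_apply, MvPolynomial.pderiv_X, Pi.single_apply, MvPolynomial.smul_eq_C_mul]

lemma pdirD_comm {n : ℕ} (a b : Vg n) : Commute (pdirD a) (pdirD b) := by
  have h : ⁅pder a, pder b⁆ = 0 := by
    apply MvPolynomial.derivation_ext
    intro i
    simp [Derivation.commutator_apply, pder_X, MvPolynomial.derivation_C]
  refine LinearMap.ext fun p => ?_
  have := congrArg (fun D => D p) h
  simp only [Derivation.commutator_apply, Derivation.coe_zero, Pi.zero_apply] at this
  simp only [Module.End.mul_apply, pdirD_eq]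
  exact sub_eq_zero.1 this

lemma evalP_hasFDerivAt {n : ℕ} (p : MvPolynomial (Fin n) ℝ) (x : Vg n) :
    ∃ L : Vg n →L[ℝ] ℝ, HasFDerivAt (evalP p) L x ∧ ∀ a, L a = evalP (pdirD a p) x := by
  induction p using MvPolynomial.induction_on with
  | C c =>
    refine ⟨0, ?_, ?_⟩
    · have : evalP (n := n) (MvPolynomial.C c) = fun _ => c := by funext y; simp [evalP]
      rw [this]; exact hasFDerivAt_const _ _
    · intro a; simp [pdirD_eq, evalP, MvPolynomial.derivation_C]
  | add p q hp hq =>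
    obtain ⟨L, hL, hL'⟩ := hp
    obtain ⟨M, hM, hM'⟩ := hq
    refine ⟨L + M, ?_, ?_⟩
    · have : evalP (p + q) = fun y => evalP p y + evalP q y := by funext y; simp [evalP]
      rw [this]; exact hL.add hM
    · intro a; simp [hL', hM', evalP]
  | mul_X p i hp =>
    obtain ⟨L, hL, hL'⟩ := hp
    have : evalP (p * MvPolynomial.X i) = fun y => evalP p y * (EuclideanSpace.proj (𝕜 := ℝ) i : Vg n →L[ℝ] ℝ) y := by
      funext y; simp [evalP]
    refine ⟨_, by rw [this]; exact hL.mul (ContinuousLinearMap.hasFDerivAt _), ?_⟩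
    intro a
    have h1 := hL' a
    simp only [pdirD_eq, evalP] at h1
    simp [pdirD_eq, evalP, pder_X, h1]

lemma evalP_temp {n : ℕ} (p : MvPolynomial (Fin n) ℝ) :
    Function.HasTemperateGrowth (evalP p) := by
  induction p using MvPolynomial.induction_on with
  | C c =>
    have : evalP (n := n) (MvPolynomial.C c) = fun _ => c := by funext y; simp [evalP]
    rw [this]; exact .const c
  | add p q hp hq =>
    have : evalP (p + q) = evalP p + evalP q := by funext y; simp [evalP]
    rw [this]; exact hp.add hq
  | mul_X p i hp =>
    have : evalP (p * MvPolynomial.X i) = evalP p * ⇑(EuclideanSpace.proj (𝕜 := ℝ) i : Vg n →L[ℝ] ℝ) := by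
      funext y; simp [evalP]
    rw [this]; exact hp.mul (ContinuousLinearMap.hasTemperateGrowth _)

lemma evalP_cont {n : ℕ} (p : MvPolynomial (Fin n) ℝ) : Continuous (evalP p) :=
  (evalP_temp p).1.continuous

lemma parL_cont {n : ℕ} (W : Submodule ℝ (Vg n)) : Continuous (parL W) :=
  LinearMap.continuous_of_finiteDimensional _

lemma key_bound {n : ℕ} {F : Type*} [NormedAddCommGroup F] [NormedSpace ℝ F]
    (W : Submodule ℝ (Vg n)) (p : MvPolynomial (Fin n) ℝ)
    (h : SchwartzMap (Vg n) F) (R : ℝ) (hR : 0 ≤ R) :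
    ∃ C : ℝ, ∀ x, ‖x‖ ≤ R → ∀ t, ‖evalP p (parL W t)‖ * ‖h (x + parL W t)‖ ≤
      C * (1 + ‖t‖) ^ (-((Module.finrank ℝ W : ℝ) + 1)) := by
  obtain ⟨N, C1, hC1, hb⟩ := (evalP_temp p).norm_iteratedFDeriv_le_uniform 0
  obtain ⟨K, hK0, hK⟩ := (LinearMap.injective_iff_antilipschitz (parL W)).1 (LinearMap.ker_eq_bot.1 (parL_inj W))
  set d := Module.finrank ℝ W
  set C2 : ℝ := 2 ^ (N + (d + 1)) * (Finset.Iic (N + (d + 1), 0)).sup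
    (fun m => SchwartzMap.seminorm ℝ m.1 m.2) h
  have hS : ∀ y, (1 + ‖y‖) ^ (N + (d + 1)) * ‖h y‖ ≤ C2 := by
    intro y
    have := SchwartzMap.one_add_le_sup_seminorm_apply (𝕜 := ℝ) (m := (N + (d+1), 0))
      (k := N + (d+1)) (n := 0) le_rfl le_rfl h y
    simpa using this
  refine ⟨C1 * (1 + R) ^ (N + (d + 1)) * C2 * (1 + K) ^ (d + 1), fun x hx t => ?_⟩
  set w := parL W t
  have h1 : ‖evalP p w‖ ≤ C1 * (1 + ‖w‖) ^ N := by simpa using hb 0 le_rfl w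
  have h2 : 1 + ‖w‖ ≤ (1 + R) * (1 + ‖x + w‖) := by
    have : ‖w‖ ≤ ‖x + w‖ + ‖x‖ := by
      have := norm_sub_le (x + w) x; simpa using this
    nlinarith [norm_nonneg (x + w)]
  have h3 : 1 + ‖t‖ ≤ (1 + K) * (1 + ‖w‖) := by
    have : ‖t‖ ≤ K * ‖w‖ := by
      simpa using hK.le_mul_dist t 0
    have hK' : (0:ℝ) ≤ K := K.2
    nlinarith [norm_nonneg w]
  have hrw : (1 + ‖t‖) ^ (-((d : ℝ) + 1)) = ((1 + ‖t‖) ^ (d + 1))⁻¹ := by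
    rw [Real.rpow_neg (by positivity), ← Real.rpow_natCast]; simp
  rw [hrw, ← div_eq_mul_inv, le_div_iff₀ (by positivity)]
  have hK' : (0:ℝ) ≤ K := K.2
  calc ‖evalP p w‖ * ‖h (x + w)‖ * (1 + ‖t‖) ^ (d + 1)
      ≤ (C1 * (1 + ‖w‖) ^ N) * ‖h (x + w)‖ * ((1 + K) * (1 + ‖w‖)) ^ (d + 1) := by gcongr
    _ = C1 * (1 + K) ^ (d + 1) * ((1 + ‖w‖) ^ (N + (d + 1)) * ‖h (x + w)‖) := by
        rw [mul_pow]; ring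
    _ ≤ C1 * (1 + K) ^ (d + 1) * (((1 + R) * (1 + ‖x + w‖)) ^ (N + (d + 1)) * ‖h (x + w)‖) := by gcongr
    _ = C1 * (1 + K) ^ (d + 1) * (1 + R) ^ (N + (d + 1)) * ((1 + ‖x + w‖) ^ (N + (d + 1)) * ‖h (x + w)‖) := by
        rw [mul_pow]; ring
    _ ≤ C1 * (1 + K) ^ (d + 1) * (1 + R) ^ (N + (d + 1)) * C2 := by gcongr; exact hS _
    _ = _ := by ring

lemma bound_int (d : ℕ) (C : ℝ) :
    Integrable (fun t : Fin d → ℝ => C * (1 + ‖t‖) ^ (-((d : ℝ) + 1))) :=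
  (integrable_one_add_norm (by simp)).const_mul C

lemma key_int {n : ℕ} (W : Submodule ℝ (Vg n)) (p : MvPolynomial (Fin n) ℝ)
    (h : SchwartzMap (Vg n) ℝ) (x : Vg n) :
    Integrable (fun t => evalP p (parL W t) * h (x + parL W t)) := by
  obtain ⟨C, hC⟩ := key_bound W p h ‖x‖ (norm_nonneg _)
  refine (bound_int _ C).mono' ?_ (Filter.Eventually.of_forall fun t => ?_)
  · exact (((evalP_cont p).comp (parL_cont W)).mul
      (h.continuous.comp (continuous_const.add (parL_cont W)))).aestronglyMeasurable
  · rw [norm_mul]; exact hC x le_rfl t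

lemma fderiv_dens {n : ℕ} (W : Submodule ℝ (Vg n)) (p : MvPolynomial (Fin n) ℝ)
    (h : SchwartzMap (Vg n) ℝ) (a : Vg n) :
    (fun x => fderiv ℝ (fun x => densOn W p (fun y => h (x + y))) x a) =
      fun x => densOn W p (fun y => LineDeriv.lineDerivOp a h (x + y)) := by
  funext x
  simp only [densOn_eq_s14]
  obtain ⟨C, hC⟩ := key_bound W p (SchwartzMap.fderivCLM ℝ (Vg n) ℝ h) (‖x‖ + 1) (by positivity)
  have hcont : Continuous (fderiv ℝ h) := (h.smooth 1).continuous_fderiv (by simp)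
  have hm : Continuous fun t => evalP p (parL W t) • fderiv ℝ h (x + parL W t) :=
    ((evalP_cont p).comp (parL_cont W)).smul (hcont.comp (continuous_const.add (parL_cont W)))
  have hbd : ∀ t, ∀ y ∈ Metric.ball x 1, ‖evalP p (parL W t) • fderiv ℝ h (y + parL W t)‖ ≤
      C * (1 + ‖t‖) ^ (-((Module.finrank ℝ W : ℝ) + 1)) := by
    intro t y hy
    rw [norm_smul]
    refine hC y ?_ t
    have h1 : ‖y - x‖ < 1 := by simpa [dist_eq_norm] using hy
    have := norm_add_le (y - x) x
    rw [sub_add_cancel] at this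
    linarith
  have key := hasFDerivAt_integral_of_dominated_of_fderiv_le (𝕜 := ℝ) (μ := volume) (x₀ := x)
    (F := fun x t => evalP p (parL W t) * h (x + parL W t))
    (F' := fun x t => evalP p (parL W t) • fderiv ℝ h (x + parL W t))
    (Metric.ball_mem_nhds x one_pos)
    (Filter.Eventually.of_forall fun y => (key_int W p h y).aestronglyMeasurable)
    (key_int W p h x) hm.aestronglyMeasurable
    (Filter.Eventually.of_forall hbd) (bound_int _ C)
    (Filter.Eventually.of_forall fun t y _ => by
      have := (h.differentiableAt (x := y + parL W t)).hasFDerivAt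
      exact ((hasFDerivAt_comp_add_right (parL W t)).2 this).const_mul _)
  rw [key.fderiv, ContinuousLinearMap.integral_apply]
  · simp [SchwartzMap.lineDerivOp_apply_eq_fderiv]
  · exact (bound_int _ C).mono' hm.aestronglyMeasurable
      (Filter.Eventually.of_forall fun t => hbd t x (Metric.mem_ball_self one_pos))

lemma dens_parts {n : ℕ} (W : Submodule ℝ (Vg n)) (p : MvPolynomial (Fin n) ℝ)
    (h : SchwartzMap (Vg n) ℝ) {a : Vg n} (ha : a ∈ W) (x : Vg n) :
    densOn W p (fun y => LineDeriv.lineDerivOp a h (x + y)) =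
      - densOn W (pdirD a p) (fun y => h (x + y)) := by
  simp only [densOn_eq_s14]
  obtain ⟨v, hv⟩ := parL_surj W ha
  let L : (Fin (Module.finrank ℝ W) → ℝ) →L[ℝ] Vg n := LinearMap.toContinuousLinearMap (parL W)
  have hL : ∀ t, L t = parL W t := fun t => rfl
  choose D hD hD' using fun t => evalP_hasFDerivAt p (parL W t)
  have := integral_bilinear_hasFDerivAt_right_eq_neg_left_of_integrable (μ := volume)
    (f := fun t => evalP p (parL W t)) (f' := fun t => (D t).comp L)
    (g := fun t => h (x + parL W t)) (g' := fun t => (fderiv ℝ h (x + parL W t)).comp L) (v := v)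
    (B := ContinuousLinearMap.mul ℝ ℝ)
    (by simpa [hL, hv, hD'] using key_int W (pdirD a p) h x)
    (by simpa [hL, hv, SchwartzMap.lineDerivOp_apply_eq_fderiv] using
        key_int W p (LineDeriv.lineDerivOp a h) x)
    (by simpa using key_int W p h x)
    (fun t _ => (hD t).comp t L.hasFDerivAt)
    (fun t _ => (h.differentiableAt (x := x + parL W t)).hasFDerivAt.comp t
      (L.hasFDerivAt.const_add x))
  simpa [hL, hv, hD', SchwartzMap.lineDerivOp_apply_eq_fderiv] using this

lemma dens_parts_list {n m : ℕ} (X : Fin m → Vg n) (W : Submodule ℝ (Vg n))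
    (p : MvPolynomial (Fin n) ℝ) (l : List (Fin m)) (hl : ∀ i ∈ l, X i ∈ W)
    (h : SchwartzMap (Vg n) ℝ) (x : Vg n) :
    densOn W p (fun y => DL X l h (x + y)) =
      (-1) ^ l.length * densOn W ((l.map fun i => pdirD (X i)).prod p) (fun y => h (x + y)) := by
  induction l generalizing h with
  | nil => simp [DL]
  | cons i l ih =>
    have e : DL X (i :: l) h = DL X l (LineDeriv.lineDerivOp (X i) h) := rfl
    rw [e, ih (fun j hj => hl j (List.mem_cons_of_mem _ hj)), dens_parts W _ h (hl i List.mem_cons_self)]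
    simp [pow_succ]

lemma foldr_dens {n m : ℕ} (X : Fin m → Vg n) (W : Submodule ℝ (Vg n)) (T : GDist n)
    (q : MvPolynomial (Fin n) ℝ) (l : List (Fin m)) (f : SchwartzMap (Vg n) ℝ) :
    l.foldr (fun i T => dirD (X i) T) T (fun x => densOn W q fun y => f (x + y)) =
      (-1) ^ l.length * T (fun x => densOn W q fun y => DL X l f (x + y)) := by
  induction l generalizing f with
  | nil => simp [DL]
  | cons i l ih =>
    rw [List.foldr_cons]
    change - (l.foldr (fun i T => dirD (X i) T) T) (fun x => fderiv ℝ _ x (X i)) = _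
    rw [fderiv_dens, ih]
    simp [DL, pow_succ]

lemma TSF_smul {n m : ℕ} (X : Fin m → Vg n) (S : Finset (Fin m)) (φ : Vg n) (c : ℝ)
    (f : Vg n → ℝ) : TSF X S φ (fun x => c * f x) = c * TSF X S φ f := by
  simp only [TSF, integral_const_mul]; ring

lemma part1 {n m : ℕ} (X : Fin m → Vg n) (W U : Submodule ℝ (Vg n)) (φ : Vg n)
    (p : MvPolynomial (Fin n) ℝ) :
    DEq (iterD X (idxOut X U) (conv (TSF X (idxOut X W) φ) (densOn W p)))
        (conv (iterD X (idxOut X U ∩ idxOut X W) (TSF X (idxOut X W) φ))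
          (densOn W (piterD X (idxIn X W \ idxIn X U) p))) := by
  intro f
  set R := idxOut X U ∩ idxOut X W
  set R' := idxIn X W \ idxIn X U
  have hperm : (idxOut X U).toList.Perm (R.toList ++ R'.toList) := by
    classical
    rw [List.perm_ext_iff_of_nodup (Finset.nodup_toList _)]
    · intro i
      simp only [R, R', Finset.mem_toList, List.mem_append, idxOut, idxIn, Finset.mem_inter,
        Finset.mem_sdiff, Finset.mem_filter, Finset.mem_univ, true_and]
      tauto
    · refine List.Nodup.append (Finset.nodup_toList _) (Finset.nodup_toList _) ?_
      intro i
      simp only [R, R', Finset.mem_toList, idxOut, idxIn, Finset.mem_inter,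
        Finset.mem_sdiff, Finset.mem_filter, Finset.mem_univ, true_and]
      tauto
  have hR' : ∀ i ∈ R'.toList, X i ∈ W := by
    intro i
    simp only [R', Finset.mem_toList, idxIn, Finset.mem_sdiff, Finset.mem_filter,
      Finset.mem_univ, true_and]
    tauto
  unfold iterD
  rw [foldr_eq, DL_perm X hperm, hperm.length_eq]
  have e : DL X (R.toList ++ R'.toList) f = DL X R'.toList (DL X R.toList f) := by
    simp [DL, List.foldl_append]
  rw [e]
  simp only [conv]
  simp only [dens_parts_list X W p _ hR']
  rw [TSF_smul, foldr_dens, ← mul_assoc, List.length_append]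
  unfold piterD
  congr 1
  rw [pow_add, mul_assoc, ← mul_pow]; simp

lemma exists_hyper {n m : ℕ} (X : Fin m → Vg n) (W U : Submodule ℝ (Vg n))
    (hW : RationalSub X W) (hWU : ¬ W ≤ U) :
    ∃ Z, CocIn X W Z ∧ Z ⊆ idxIn X W \ idxIn X U := by
  let S : Set (Submodule ℝ (Vg n)) := {H | RationalSub X H ∧ H < W ∧
    ∀ i, X i ∈ U → X i ∈ W → X i ∈ H}
  have ratspan : ∀ A : Set (Vg n), A ⊆ Set.range X → RationalSub X (Submodule.span ℝ A) := by
    intro A hA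
    apply le_antisymm
    · exact Submodule.span_mono fun a ha => ⟨hA ha, Submodule.subset_span ha⟩
    · exact Submodule.span_le.2 fun a ha => ha.2
  have hS : S.Nonempty := by
    refine ⟨Submodule.span ℝ (Set.range X ∩ (U ⊓ W : Submodule ℝ (Vg n))),
      ratspan _ Set.inter_subset_left, ?_, fun i h1 h2 =>
        Submodule.subset_span ⟨⟨i, rfl⟩, h1, h2⟩⟩
    have h1 : Submodule.span ℝ (Set.range X ∩ (U ⊓ W : Submodule ℝ (Vg n))) ≤ U ⊓ W :=
      Submodule.span_le.2 fun a ha => ha.2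
    exact lt_of_le_of_lt h1 (inf_lt_right.2 hWU)
  obtain ⟨H, ⟨hr, hlt, hU⟩, hmax⟩ := (wellFounded_gt (α := Submodule ℝ (Vg n))).has_min S hS
  have : ∃ i, X i ∈ W ∧ X i ∉ H := by
    by_contra! hcon
    apply not_le_of_gt hlt
    rw [hW]
    refine Submodule.span_le.2 ?_
    rintro _ ⟨⟨i, rfl⟩, hi⟩
    exact hcon i hi
  obtain ⟨i, hi, hiH⟩ := this
  have hle : H ⊔ Submodule.span ℝ {X i} ≤ W :=
    sup_le hlt.le (Submodule.span_le.2 (by simpa using hi))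
  have hlt2 : H < H ⊔ Submodule.span ℝ {X i} := by
    refine lt_of_le_of_ne le_sup_left fun h => hiH ?_
    rw [h]
    exact (le_sup_right : _ ≤ H ⊔ _) (Submodule.mem_span_singleton_self _)
  have heq : H ⊔ Submodule.span ℝ {X i} = W := by
    by_contra hne
    refine hmax _ ⟨?_, lt_of_le_of_ne hle hne, fun j h1 h2 => hlt2.le (hU j h1 h2)⟩ hlt2
    have : H ⊔ Submodule.span ℝ {X i} = Submodule.span ℝ ((Set.range X ∩ H) ∪ {X i}) := by
      rw [Submodule.span_union, ← hr]
    rw [this]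
    exact ratspan _ (Set.union_subset Set.inter_subset_left (by simp))
  refine ⟨_, ⟨H, hr, hlt.le, ?_, rfl⟩, ?_⟩
  · apply le_antisymm (Submodule.finrank_lt_finrank_of_lt hlt)
    have h1 := Submodule.finrank_add_le_finrank_add_finrank H (Submodule.span ℝ {X i})
    rw [heq] at h1
    have h2 := finrank_span_le_card (R := ℝ) ({X i} : Set (Vg n))
    simp at h2
    omega
  · intro j
    simp only [idxIn, Finset.mem_sdiff, Finset.mem_filter, Finset.mem_univ, true_and]
    exact fun ⟨h1, h2⟩ => ⟨h1, fun h3 => h2 (hU j h3 h1)⟩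

lemma vanish_pdirD {n : ℕ} (W : Submodule ℝ (Vg n)) (p : MvPolynomial (Fin n) ℝ)
    (h : ∀ w ∈ W, evalP p w = 0) {a : Vg n} (ha : a ∈ W) : ∀ w ∈ W, evalP (pdirD a p) w = 0 := by
  intro w hw
  obtain ⟨L, hL, hL'⟩ := evalP_hasFDerivAt p w
  rw [← hL']
  have h1 := (hL.hasLineDerivAt a)
  unfold HasLineDerivAt at h1
  have h2 : (fun t : ℝ => evalP p (w + t • a)) = fun _ => 0 := by
    funext t; exact h _ (W.add_mem hw (W.smul_mem t ha))
  rw [h2] at h1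
  exact h1.unique (hasDerivAt_const _ _)

lemma vanish_list {n m : ℕ} (X : Fin m → Vg n) (W : Submodule ℝ (Vg n))
    (p : MvPolynomial (Fin n) ℝ) (h : ∀ w ∈ W, evalP p w = 0) (l : List (Fin m))
    (hl : ∀ i ∈ l, X i ∈ W) : ∀ w ∈ W, evalP ((l.map fun i => pdirD (X i)).prod p) w = 0 := by
  induction l with
  | nil => simpa using h
  | cons i l ih =>
    simp only [List.map_cons, List.prod_cons, Module.End.mul_apply]
    exact vanish_pdirD W _ (ih fun j hj => hl j (List.mem_cons_of_mem _ hj)) (hl i List.mem_cons_self)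

lemma vanish {n m : ℕ} (X : Fin m → Vg n) (W U : Submodule ℝ (Vg n))
    (hW : RationalSub X W) (hWU : ¬ W ≤ U)
    (p : MvPolynomial (Fin n) ℝ) (hp : DcondOn X W p) :
    ∀ w ∈ W, evalP (piterD X (idxIn X W \ idxIn X U) p) w = 0 := by
  obtain ⟨Z, hZ, hsub⟩ := exists_hyper X W U hW hWU
  set R' := idxIn X W \ idxIn X U
  have hperm : R'.toList.Perm ((R' \ Z).toList ++ Z.toList) := by
    rw [List.perm_ext_iff_of_nodup (Finset.nodup_toList _)]
    · intro i
      simp only [Finset.mem_toList, List.mem_append, Finset.mem_sdiff]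
      have := @hsub i
      tauto
    · refine List.Nodup.append (Finset.nodup_toList _) (Finset.nodup_toList _) ?_
      intro i
      simp only [Finset.mem_toList, Finset.mem_sdiff]
      tauto
  have hprod : (R'.toList.map fun i => pdirD (X i)).prod =
      (((R' \ Z).toList ++ Z.toList).map fun i => pdirD (X i)).prod := by
    refine (hperm.map _).prod_eq' ?_
    rw [List.pairwise_map]
    exact List.pairwise_of_forall fun i j => pdirD_comm _ _
  unfold piterD
  rw [hprod, List.map_append, List.prod_append]
  simp only [Module.End.mul_apply]
  refine vanish_list X W _ (fun w hw => hp Z hZ ⟨w, hw⟩) _ ?_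
  intro i
  simp only [R', Finset.mem_toList, idxIn, Finset.mem_sdiff, Finset.mem_filter,
    Finset.mem_univ, true_and]
  tauto

theorem stmt14 {n m : ℕ} (X : Fin m → Vg n)
    (hX0 : ∀ i, X i ≠ 0)
    (hspan : Submodule.span ℝ (Set.range X) = ⊤)
    (W U : Submodule ℝ (Vg n))          -- W = r̲, U = t̲
    (hW : RationalSub X W) (hU : RationalSub X U)
    (φ : Vg n)                          -- a regular face F_{r̲} for X∖r̲
    (hφ : ∀ i, X i ∉ W → inner (𝕜 := ℝ) φ (X i) ≠ 0)
    (p : MvPolynomial (Fin n) ℝ) (hp : DcondOn X W p) :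
    DEq (iterD X (idxOut X U) (conv (TSF X (idxOut X W) φ) (densOn W p)))
        (conv (iterD X (idxOut X U ∩ idxOut X W) (TSF X (idxOut X W) φ))
          (densOn W (piterD X (idxIn X W \ idxIn X U) p))) ∧
    (¬ W ≤ U →
      DEq (iterD X (idxOut X U) (conv (TSF X (idxOut X W) φ) (densOn W p))) 0) := by
  refine ⟨part1 X W U φ p, fun hWU f => ?_⟩
  rw [part1 X W U φ p f]
  have hv := vanish X W U hW hWU p hp
  have hd : ∀ g : Vg n → ℝ, densOn W (piterD X (idxIn X W \ idxIn X U) p) g = 0 := by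
    intro g
    rw [densOn_eq_s14]
    simp [hv _ (parL_mem W _)]
  simp only [conv, iterD]
  rw [foldr_dens]
  simp [hd, TSF]
end
end
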